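/- arXiv:1804.05643 — 3 statements merged into one kernel-verified Lean document; each statement's English description precedes it below -/
import Mathlib

section
/- Let F ∈ F_q[x_1,...,x_n] be a non-singular cubic form with char(F_q) > 3, n ≥ 4. Then for every prime ϖ of F_q[t] and every e ≥ 1, S_0(ϖ^e) = #{x mod ϖ^e : F(x) ≡ 0 mod ϖ^e} ≪ |ϖ|^{e(n−1)}, with implied constant independent of q and ϖ. -/
open scoped Classical BigOperators
open Polynomial

noncomputable section

/-- `S₀(ϖ^e)`: the number of solutions `x mod ϖ^e` of `F(x) ≡ 0 (mod ϖ^e)`,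
where each coordinate runs over polynomial representatives of degree `< e·deg ϖ`. -/
def S0 {Fq : Type} [Field Fq] {n : ℕ} (F : MvPolynomial (Fin n) Fq)
    (ϖ : Polynomial Fq) (e : ℕ) : ℕ :=
  Nat.card {x : Fin n → Polynomial Fq //
    (∀ i, (x i).degree < ((e * ϖ.natDegree : ℕ) : WithBot ℕ)) ∧
    ϖ ^ e ∣ MvPolynomial.aeval x F}

/-- `S₁(ϖ^e)`: as `S₀(ϖ^e)` but restricted to `x` with `ϖ ∤ x`. -/
def S1 {Fq : Type} [Field Fq] {n : ℕ} (F : MvPolynomial (Fin n) Fq)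
    (ϖ : Polynomial Fq) (e : ℕ) : ℕ :=
  Nat.card {x : Fin n → Polynomial Fq //
    (∀ i, (x i).degree < ((e * ϖ.natDegree : ℕ) : WithBot ℕ)) ∧
    (∃ i, ¬ ϖ ∣ x i) ∧ ϖ ^ e ∣ MvPolynomial.aeval x F}

/-- A form is non-singular if, over the algebraic closure, the only common zero of
its partial derivatives is the origin. -/
def NonsingularForm {Fq : Type} [Field Fq] {n : ℕ}
    (F : MvPolynomial (Fin n) Fq) : Prop :=
  ∀ x : Fin n → AlgebraicClosure Fq,
    (∀ i, MvPolynomial.aeval x (MvPolynomial.pderiv i F) = 0) → x = 0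


/-- Polynomials of degree less than `m`, as a finset. -/
lemma aux_finite (Fq : Type) [Field Fq] [Fintype Fq] (m : ℕ) :
    {p : Fq[X] | p.degree < (m : WithBot ℕ)}.Finite := by
  have h : Finite (Polynomial.degreeLT Fq m) :=
    Finite.of_equiv _ (Polynomial.degreeLTEquiv Fq m).toEquiv.symm
  have h2 : (↑(Polynomial.degreeLT Fq m) : Set Fq[X]).Finite := Set.toFinite _
  refine h2.subset ?_
  intro p hp
  exact Polynomial.mem_degreeLT.2 hp

def VV (Fq : Type) [Field Fq] [Fintype Fq] (m : ℕ) : Finset Fq[X] := (aux_finite Fq m).toFinset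

lemma mem_VV {Fq : Type} [Field Fq] [Fintype Fq] {m : ℕ} {p : Fq[X]} :
    p ∈ VV Fq m ↔ p.degree < (m : WithBot ℕ) := by simp [VV]

lemma card_VV (Fq : Type) [Field Fq] [Fintype Fq] (m : ℕ) :
    (VV Fq m).card = Fintype.card Fq ^ m := by
  have h1 : Nat.card (Polynomial.degreeLT Fq m) = Fintype.card Fq ^ m := by
    rw [Nat.card_congr (Polynomial.degreeLTEquiv Fq m).toEquiv]
    simp
  rw [← h1, ← Nat.card_eq_finsetCard]
  exact Nat.card_congr (Equiv.subtypeEquivRight fun p => by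
    rw [mem_VV, Polynomial.mem_degreeLT])

lemma mod_mem {Fq : Type} [Field Fq] [Fintype Fq] {ϖ : Fq[X]} (hm : ϖ.Monic) (f : ℕ) (p : Fq[X]) :
    p %ₘ (ϖ ^ f) ∈ VV Fq (f * ϖ.natDegree) := by
  rw [mem_VV]
  have h := degree_modByMonic_lt p (hm.pow f)
  rwa [degree_eq_natDegree (hm.pow f).ne_zero, hm.natDegree_pow] at h

lemma divMonic_mem_VV {Fq : Type} [Field Fq] [Fintype Fq] {ϖ : Fq[X]} (hm : ϖ.Monic) (f k : ℕ) (p : Fq[X])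
    (hp : p ∈ VV Fq ((f + k) * ϖ.natDegree)) :
    p /ₘ (ϖ ^ f) ∈ VV Fq (k * ϖ.natDegree) := by
  rw [mem_VV] at *
  by_cases h0 : p /ₘ (ϖ ^ f) = 0
  · rw [h0, degree_zero]; exact WithBot.bot_lt_coe _
  · have h2 : p ≠ 0 := by rintro rfl; simp at h0
    rw [degree_eq_natDegree h0, natDegree_divByMonic _ (hm.pow f), hm.natDegree_pow]
    rw [degree_eq_natDegree h2] at hp
    norm_cast at *
    have h3 : f * ϖ.natDegree ≤ p.natDegree := by
      by_contra hlt
      apply h0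
      rw [divByMonic_eq_zero_iff (hm.pow f), degree_eq_natDegree h2,
        degree_eq_natDegree (hm.pow f).ne_zero, hm.natDegree_pow]
      exact_mod_cast not_le.1 hlt
    rw [add_mul] at hp
    omega

lemma eq_of_dvd {Fq : Type} [Field Fq] [Fintype Fq] {ϖ : Fq[X]} (hm : ϖ.Monic) (e : ℕ) {p r : Fq[X]}
    (hp : p ∈ VV Fq (e * ϖ.natDegree)) (hr : r ∈ VV Fq (e * ϖ.natDegree))
    (h : ϖ ^ e ∣ p - r) : p = r := by
  rw [mem_VV] at *
  rw [← sub_eq_zero]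
  apply eq_zero_of_dvd_of_degree_lt h
  rw [degree_eq_natDegree (hm.pow e).ne_zero, hm.natDegree_pow]
  exact (degree_sub_le p r).trans_lt (max_lt hp hr)

/-- evaluation respects congruences -/
lemma eval_congr_dvd {Fq : Type} [Field Fq] {n : ℕ} (F : MvPolynomial (Fin n) Fq) (m : Fq[X])
    (x y : Fin n → Fq[X]) (h : ∀ i, m ∣ x i - y i) :
    m ∣ MvPolynomial.aeval x F - MvPolynomial.aeval y F := by
  induction F using MvPolynomial.induction_on with
  | C a => simp
  | add p q hp hq =>
    have := dvd_add hp hq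
    rw [map_add, map_add]
    convert this using 1; ring
  | mul_X p i hp =>
    have := dvd_add (hp.mul_right (x i)) ((h i).mul_left (MvPolynomial.aeval y p))
    simp only [map_mul, MvPolynomial.aeval_X]
    convert this using 1; ring

lemma taylor_dvd {Fq : Type} [Field Fq] {n : ℕ} (F : MvPolynomial (Fin n) Fq) (c : Fq[X])
    (x : Fin n → Fq[X]) (i : Fin n) :
    c ^ 2 ∣ MvPolynomial.aeval (x + Pi.single i c) F - MvPolynomial.aeval x F
      - c * MvPolynomial.aeval x (MvPolynomial.pderiv i F) := by
  induction F using MvPolynomial.induction_on with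
  | C a => simp
  | add p q hp hq =>
    have := dvd_add hp hq
    simp only [map_add]
    convert this using 1; ring
  | mul_X p j hp =>
    have h2 : c ∣ MvPolynomial.aeval (x + Pi.single i c) p - MvPolynomial.aeval x p := by
      apply eval_congr_dvd
      intro k
      by_cases hk : k = i
      · subst hk; simp
      · simp [Pi.single_eq_of_ne hk]
    obtain ⟨u, hu⟩ := hp
    obtain ⟨v, hv⟩ := h2
    rw [MvPolynomial.pderiv_mul, map_add, map_mul, map_mul, map_mul, map_mul,
      MvPolynomial.aeval_X, MvPolynomial.aeval_X, Pi.add_apply]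
    generalize MvPolynomial.aeval (x + Pi.single i c) p = A at *
    generalize MvPolynomial.aeval x p = B at *
    generalize MvPolynomial.aeval x (MvPolynomial.pderiv i p) = D at *
    by_cases hk : j = i
    · subst hk
      rw [MvPolynomial.pderiv_X_self, Pi.single_eq_same, map_one]
      exact ⟨u * x j + v, by linear_combination x j * hu + c * hv⟩
    · rw [MvPolynomial.pderiv_X_of_ne hk, Pi.single_eq_of_ne hk, map_zero]
      exact ⟨u * x j, by linear_combination x j * hu⟩

lemma homog_eval {Fq : Type} [Field Fq] {n d : ℕ} {F : MvPolynomial (Fin n) Fq}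
    (hF : F.IsHomogeneous d) (c : Fq[X]) (y : Fin n → Fq[X]) :
    MvPolynomial.aeval (fun i => c * y i) F = c ^ d * MvPolynomial.aeval y F := by
  rw [MvPolynomial.aeval_def, MvPolynomial.aeval_def, MvPolynomial.eval₂_eq,
    MvPolynomial.eval₂_eq, Finset.mul_sum]
  refine Finset.sum_congr rfl fun s hs => ?_
  have := hF.degree_eq_sum_deg_support hs
  simp only [mul_pow, Finset.prod_mul_distrib, Finset.prod_pow_eq_pow_sum]
  rw [← this]; ring

section main
variable {Fq : Type} [Field Fq] [Fintype Fq] {n : ℕ}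

def T0 (F : MvPolynomial (Fin n) Fq) (ϖ : Fq[X]) (e : ℕ) : Finset (Fin n → Fq[X]) :=
  (Fintype.piFinset fun _ => VV Fq (e * ϖ.natDegree)).filter
    fun x => ϖ ^ e ∣ MvPolynomial.aeval x F

def T1 (F : MvPolynomial (Fin n) Fq) (ϖ : Fq[X]) (e : ℕ) : Finset (Fin n → Fq[X]) :=
  (T0 F ϖ e).filter fun x => ∃ i, ¬ ϖ ∣ x i

lemma mem_T0 {F : MvPolynomial (Fin n) Fq} {ϖ : Fq[X]} {e : ℕ} {x : Fin n → Fq[X]} :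
    x ∈ T0 F ϖ e ↔ (∀ i, x i ∈ VV Fq (e * ϖ.natDegree)) ∧ ϖ ^ e ∣ MvPolynomial.aeval x F := by
  simp [T0]

lemma mem_T1 {F : MvPolynomial (Fin n) Fq} {ϖ : Fq[X]} {e : ℕ} {x : Fin n → Fq[X]} :
    x ∈ T1 F ϖ e ↔ x ∈ T0 F ϖ e ∧ ∃ i, ¬ ϖ ∣ x i := by
  simp [T1]

lemma S0_eq (F : MvPolynomial (Fin n) Fq) (ϖ : Fq[X]) (e : ℕ) : S0 F ϖ e = (T0 F ϖ e).card := by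
  unfold S0
  rw [← Nat.card_eq_finsetCard]
  exact Nat.card_congr (Equiv.subtypeEquivRight fun x => by
    simp only [mem_T0, mem_VV])

lemma exists_root {ϖ : Fq[X]} (hm : ϖ.Monic) (hi : Irreducible ϖ) :
    ∃ α : AlgebraicClosure Fq, ∀ p : Fq[X], aeval α p = 0 ↔ ϖ ∣ p := by
  obtain ⟨α, hα⟩ := IsAlgClosed.exists_aeval_eq_zero (AlgebraicClosure Fq) ϖ
    (Polynomial.degree_pos_of_irreducible hi).ne'
  refine ⟨α, fun p => ?_⟩
  rw [minpoly.eq_of_irreducible_of_monic hi hα hm, minpoly.dvd_iff]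

lemma aeval_comp_aux (α : AlgebraicClosure Fq) (F : MvPolynomial (Fin n) Fq) (y : Fin n → Fq[X]) :
    MvPolynomial.aeval (fun i => aeval α (y i)) F = aeval α (MvPolynomial.aeval y F) := by
  rw [← MvPolynomial.comp_aeval_apply]

lemma exists_pderiv {F : MvPolynomial (Fin n) Fq} (hN : NonsingularForm F) {ϖ : Fq[X]}
    (hm : ϖ.Monic) (hi : Irreducible ϖ) (y : Fin n → Fq[X]) (hy : ∃ i, ¬ ϖ ∣ y i) :
    ∃ i, ¬ ϖ ∣ MvPolynomial.aeval y (MvPolynomial.pderiv i F) := by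
  by_contra! hcon
  obtain ⟨α, hα⟩ := exists_root hm hi
  obtain ⟨i, hi'⟩ := hy
  have := hN (fun i => aeval α (y i)) fun j => by
    rw [aeval_comp_aux, hα]; exact hcon j
  exact hi' ((hα _).1 (congrFun this i))

lemma T0_one {F : MvPolynomial (Fin n) Fq} (hF : F.IsHomogeneous 3) (hF0 : F ≠ 0) (hn : 1 ≤ n)
    {ϖ : Fq[X]} (hm : ϖ.Monic) (hi : Irreducible ϖ) :
    (T0 F ϖ 1).card ≤ 3 * (Fintype.card Fq ^ ϖ.natDegree) ^ (n - 1) := by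
  obtain ⟨α, hα⟩ := exists_root hm hi
  set Q := Fintype.card Fq ^ ϖ.natDegree with hQ
  have hQ0 : 0 < Q := pow_pos Fintype.card_pos _
  have hinj : ∀ p ∈ VV Fq (1 * ϖ.natDegree), ∀ r ∈ VV Fq (1 * ϖ.natDegree),
      aeval α p = aeval α r → p = r := by
    intro p hp r hr h
    refine eq_of_dvd hm 1 hp hr ?_
    rw [pow_one, ← hα, map_sub, h, sub_self]
  set S : Finset (AlgebraicClosure Fq) := (VV Fq (1 * ϖ.natDegree)).image (aeval α) with hS
  have hScard : S.card = Q := by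
    rw [hS, Finset.card_image_of_injOn (fun p hp r hr h => hinj p hp r hr h), card_VV, one_mul]
  set P := MvPolynomial.map (algebraMap Fq (AlgebraicClosure Fq)) F with hP
  have hP0 : P ≠ 0 := by
    intro h
    exact hF0 (MvPolynomial.map_injective _ (algebraMap Fq (AlgebraicClosure Fq)).injective
      (by rw [map_zero]; exact h))
  have hle : (T0 F ϖ 1).card ≤
      ((Fintype.piFinset fun _ : Fin n => S).filter fun f => MvPolynomial.eval f P = 0).card := by
    apply Finset.card_le_card_of_injOn (fun x i => aeval α (x i))
    · intro x hx
      have hx := mem_T0.1 hx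
      simp only [Finset.coe_filter, Set.mem_ofPred_eq, Fintype.mem_piFinset]
      refine ⟨fun i => Finset.mem_image_of_mem _ (hx.1 i), ?_⟩
      rw [hP, MvPolynomial.eval_map, ← MvPolynomial.aeval_def, aeval_comp_aux, hα]
      simpa using hx.2
    · intro x hx y hy hxy
      have hx := mem_T0.1 hx
      have hy := mem_T0.1 hy
      funext i
      exact hinj _ (hx.1 i) _ (hy.1 i) (congrFun hxy i)
  have hsz := MvPolynomial.schwartz_zippel_totalDegree hP0 S
  have hdeg : P.totalDegree ≤ 3 := (hF.map _).totalDegree_le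
  rw [hScard] at hsz
  refine hle.trans ?_
  have hQ1 : (0 : ℚ≥0) < Q := by exact_mod_cast hQ0
  rw [div_le_div_iff₀ (by positivity) hQ1] at hsz
  norm_cast at hsz
  obtain ⟨m, rfl⟩ : ∃ m, n = m + 1 := ⟨n - 1, by omega⟩
  simp only [Nat.add_sub_cancel]
  have h3 := hsz.trans (Nat.mul_le_mul_right _ hdeg)
  rw [pow_succ, ← mul_assoc] at h3
  exact Nat.le_of_mul_le_mul_right h3 hQ0

lemma T1_succ {F : MvPolynomial (Fin n) Fq} (hN : NonsingularForm F)
    {ϖ : Fq[X]} (hm : ϖ.Monic) (hi : Irreducible ϖ) (e : ℕ) (he : 1 ≤ e) :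
    (T1 F ϖ (e + 1)).card ≤ (Fintype.card Fq ^ ϖ.natDegree) ^ (n - 1) * (T1 F ϖ e).card := by
  have hpr : Prime ϖ := hi.prime
  have hmodd : ∀ p : Fq[X], ϖ ^ e ∣ p %ₘ ϖ ^ e - p := fun p => dvd_modByMonic_sub p _
  have hde : ϖ ∣ ϖ ^ e := dvd_pow_self _ (by omega)
  apply Finset.card_le_mul_card_image_of_maps_to (f := fun x i => x i %ₘ ϖ ^ e)
  · intro x hx
    rw [mem_T1, mem_T0] at *
    obtain ⟨⟨hx1, hx2⟩, i, hxi⟩ := hx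
    refine ⟨⟨fun i => mod_mem hm _ _, ?_⟩, i, ?_⟩
    · have h1 := eval_congr_dvd F (ϖ ^ e) (fun i => x i %ₘ ϖ ^ e) x (fun i => hmodd _)
      exact (dvd_iff_dvd_of_dvd_sub h1).2 ((pow_dvd_pow ϖ (Nat.le_succ e)).trans hx2)
    · intro h
      exact hxi ((dvd_iff_dvd_of_dvd_sub (hde.trans (hmodd (x i)))).1 h)
  · intro y hy
    rw [mem_T1, mem_T0] at hy
    obtain ⟨i, hi'⟩ := exists_pderiv hN hm hi y hy.2
    have hcard : (Fintype.piFinset fun _ : {j : Fin n // j ≠ i} => VV Fq (1 * ϖ.natDegree)).card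
        = (Fintype.card Fq ^ ϖ.natDegree) ^ (n - 1) := by
      rw [Fintype.card_piFinset]
      simp [card_VV, Fintype.card_subtype_compl]
    rw [← hcard]
    apply Finset.card_le_card_of_injOn (fun x j => x j.1 /ₘ ϖ ^ e)
    · intro x hx
      simp only [Finset.coe_filter, Set.mem_ofPred_eq, mem_T1, mem_T0] at hx
      simp only [Finset.mem_coe, Fintype.mem_piFinset]
      intro j
      exact divMonic_mem_VV hm e 1 _ (hx.1.1.1 _)
    · intro x hx x' hx' hxx
      simp only [Finset.coe_filter, Set.mem_ofPred_eq, mem_T1, mem_T0] at hx hx'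
      have hmod : ∀ j, x j %ₘ ϖ ^ e = x' j %ₘ ϖ ^ e := fun j =>
        (congrFun hx.2 j).trans (congrFun hx'.2 j).symm
      have hoff : ∀ j, j ≠ i → x j = x' j := by
        intro j hj
        have := congrFun hxx ⟨j, hj⟩
        simp only at this
        rw [← modByMonic_add_div (x j) (ϖ ^ e), ← modByMonic_add_div (x' j) (ϖ ^ e), hmod j, this]
      set w := x' i /ₘ ϖ ^ e - x i /ₘ ϖ ^ e with hw
      have hdiff : x' i = x i + ϖ ^ e * w := by
        rw [hw]
        have h1 := modByMonic_add_div (x i) (ϖ ^ e)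
        have h2 := modByMonic_add_div (x' i) (ϖ ^ e)
        have h3 := hmod i
        linear_combination h1 - h2 - h3
      have hx'eq : x' = x + Pi.single i (ϖ ^ e * w) := by
        funext j
        by_cases hj : j = i
        · subst hj; simpa using hdiff
        · simp [Pi.single_eq_of_ne hj, hoff j hj]
      have hT := taylor_dvd F (ϖ ^ e * w) x i
      rw [← hx'eq] at hT
      have hp2 : ϖ ^ (e + 1) ∣ (ϖ ^ e * w) ^ 2 := by
        rw [mul_pow, ← pow_mul]
        exact (pow_dvd_pow ϖ (by omega)).mul_right _
      have hdv : ϖ ^ (e + 1) ∣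
          ϖ ^ e * w * MvPolynomial.aeval x (MvPolynomial.pderiv i F) :=
        (dvd_iff_dvd_of_dvd_sub (hp2.trans hT)).1 (dvd_sub hx'.1.1.2 hx.1.1.2)
      rw [pow_succ, mul_assoc] at hdv
      have hdv2 := (mul_dvd_mul_iff_left (pow_ne_zero e hpr.ne_zero)).1 hdv
      have hnd : ¬ ϖ ∣ MvPolynomial.aeval x (MvPolynomial.pderiv i F) := by
        intro h
        apply hi'
        refine (dvd_iff_dvd_of_dvd_sub (eval_congr_dvd _ ϖ y x fun j => ?_)).2 h
        rw [← hx.2]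
        exact hde.trans (hmodd _)
      have hwd : ϖ ∣ w := (hpr.dvd_or_dvd hdv2).resolve_right hnd
      funext j
      by_cases hj : j = i
      · subst hj
        refine (eq_of_dvd hm (e + 1) (hx'.1.1.1 _) (hx.1.1.1 _) ?_).symm
        rw [hdiff, add_sub_cancel_left, pow_succ]
        exact mul_dvd_mul_left _ hwd
      · exact hoff j hj

lemma T0_rec {F : MvPolynomial (Fin n) Fq} (hF : F.IsHomogeneous 3)
    {ϖ : Fq[X]} (hm : ϖ.Monic) (f k : ℕ) (hk : f = 0 ∨ k = 2) :
    (T0 F ϖ (f + k + 1)).card ≤ (T1 F ϖ (f + k + 1)).card +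
      (T0 F ϖ f).card * (Fintype.card Fq ^ ϖ.natDegree) ^ (k * n) := by
  rw [← Finset.card_filter_add_card_filter_not (s := T0 F ϖ (f + k + 1))
    (fun x => ∃ i, ¬ ϖ ∣ x i)]
  refine Nat.add_le_add le_rfl ?_
  have hcard : (Fintype.piFinset fun _ : Fin n => VV Fq (k * ϖ.natDegree)).card
        = (Fintype.card Fq ^ ϖ.natDegree) ^ (k * n) := by
    rw [Fintype.card_piFinset]
    simp [card_VV, ← pow_mul]
    ring_nf
  rw [← hcard, ← Finset.card_product]
  apply Finset.card_le_card_of_injOn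
    (fun x => (fun i => (x i /ₘ ϖ ^ 1) %ₘ ϖ ^ f, fun i => (x i /ₘ ϖ ^ 1) /ₘ ϖ ^ f))
  · intro x hx
    simp only [Finset.coe_filter, Set.mem_ofPred_eq, mem_T0, not_exists, not_not] at hx
    obtain ⟨⟨hx1, hx2⟩, hx3⟩ := hx
    have hxy : ∀ i, ϖ * (x i /ₘ ϖ ^ 1) = x i := by
      intro i
      have := modByMonic_add_div (x i) (ϖ ^ 1)
      rw [(modByMonic_eq_zero_iff_dvd (hm.pow 1)).2 (by simpa using hx3 i), zero_add] at this
      simpa using this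
    simp only [Finset.coe_product, Set.mem_prod, Finset.mem_coe, mem_T0, Fintype.mem_piFinset]
    refine ⟨⟨fun i => mod_mem hm _ _, ?_⟩, fun i => ?_⟩
    · rcases hk with rfl | rfl
      · simp
      · have h1 := homog_eval hF ϖ (fun i => x i /ₘ ϖ ^ 1)
        simp only [hxy] at h1
        rw [h1, show f + 2 + 1 = 3 + f by ring, pow_add] at hx2
        have h2 := (mul_dvd_mul_iff_left (pow_ne_zero 3 hm.ne_zero)).1 hx2
        exact (dvd_iff_dvd_of_dvd_sub (eval_congr_dvd F (ϖ ^ f) _ _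
          fun i => dvd_modByMonic_sub _ _)).2 h2
    · apply divMonic_mem_VV hm
      apply divMonic_mem_VV hm
      rw [add_comm 1]
      exact hx1 i
  · intro x hx y hy hxy
    simp only [Finset.coe_filter, Set.mem_ofPred_eq, mem_T0, not_exists, not_not] at hx hy
    have hh : ∀ x : Fin n → Fq[X], (∀ i, ϖ ∣ x i) → ∀ i, ϖ * (x i /ₘ ϖ ^ 1) = x i := by
      intro x hx3 i
      have := modByMonic_add_div (x i) (ϖ ^ 1)
      rw [(modByMonic_eq_zero_iff_dvd (hm.pow 1)).2 (by simpa using hx3 i), zero_add] at this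
      simpa using this
    rw [Prod.mk.injEq] at hxy
    funext i
    rw [← hh x hx.2 i, ← hh y hy.2 i]
    congr 1
    rw [← modByMonic_add_div (x i /ₘ ϖ ^ 1) (ϖ ^ f), ← modByMonic_add_div (y i /ₘ ϖ ^ 1) (ϖ ^ f)]
    have h1 := congrFun hxy.1 i
    have h2 := congrFun hxy.2 i
    rw [h1, h2]

lemma T1_bound {F : MvPolynomial (Fin n) Fq} (hF : F.IsHomogeneous 3) (hF0 : F ≠ 0) (hn : 1 ≤ n)
    (hN : NonsingularForm F) {ϖ : Fq[X]} (hm : ϖ.Monic) (hi : Irreducible ϖ) (e : ℕ) (he : 1 ≤ e) :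
    (T1 F ϖ e).card ≤ 3 * (Fintype.card Fq ^ ϖ.natDegree) ^ (e * (n - 1)) := by
  induction e, he using Nat.le_induction with
  | base =>
    rw [one_mul]
    exact (Finset.card_filter_le _ _).trans (T0_one hF hF0 hn hm hi)
  | succ e he ih =>
    refine (T1_succ hN hm hi e he).trans ((Nat.mul_le_mul_left _ ih).trans (le_of_eq ?_))
    ring

lemma T0_bound {F : MvPolynomial (Fin n) Fq} (hF : F.IsHomogeneous 3) (hF0 : F ≠ 0) (hn : 4 ≤ n)
    (hN : NonsingularForm F) {ϖ : Fq[X]} (hm : ϖ.Monic) (hi : Irreducible ϖ) (e : ℕ) :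
    (T0 F ϖ e).card ≤ 6 * (Fintype.card Fq ^ ϖ.natDegree) ^ (e * (n - 1)) := by
  set Q := Fintype.card Fq ^ ϖ.natDegree with hQ
  have hQ2 : 2 ≤ Q := by
    have h1 : 2 ≤ Fintype.card Fq := Fintype.one_lt_card
    exact h1.trans (Nat.le_self_pow hi.natDegree_pos.ne' _)
  have hzero : (T0 F ϖ 0).card ≤ 1 := by
    rw [Finset.card_le_one]
    intro x hx y hy
    rw [mem_T0] at hx hy
    funext i
    exact eq_of_dvd hm 0 (hx.1 i) (hy.1 i) (by simp)
  obtain ⟨m, rfl⟩ : ∃ m, n = m + 4 := ⟨n - 4, by omega⟩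
  have hb := fun e he => T1_bound hF hF0 (by omega) hN hm hi e he
  rw [← hQ] at hb
  induction e using Nat.strong_induction_on with
  | _ e ih =>
  match e, ih with
  | 0, _ => simp; omega
  | 1, _ =>
    have h1 := T0_rec hF hm 0 0 (Or.inl rfl)
    have h2 := hb 1 le_rfl
    have h3 : 1 ≤ Q ^ (1 * (m + 4 - 1)) := Nat.one_le_pow _ _ (by omega)
    simp only [zero_add, zero_mul, pow_zero, mul_one] at h1
    omega
  | 2, _ =>
    have h1 := T0_rec hF hm 0 1 (Or.inl rfl)
    have h2 := hb 2 (by omega)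
    have h3 : Q ^ (1 * (m + 4)) ≤ Q ^ (2 * (m + 4 - 1)) := Nat.pow_le_pow_right (by omega) (by omega)
    have h4 := Nat.mul_le_mul_right (Q ^ (1 * (m + 4))) hzero
    rw [← hQ] at h1
    simp only [zero_add, Nat.reduceAdd] at h1
    omega
  | f + 3, ih =>
    have h1 := T0_rec hF hm f 2 (Or.inr rfl)
    have h2 := hb (f + 3) (by omega)
    have h3 := Nat.mul_le_mul_right (Q ^ (2 * (m + 4))) (ih f (by omega))
    rw [← hQ, show f + 2 + 1 = f + 3 from rfl] at h1
    have h4 : 2 * (Q ^ (f * (m + 4 - 1)) * Q ^ (2 * (m + 4))) ≤ Q ^ ((f + 3) * (m + 4 - 1)) := by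
      rw [← pow_add]
      calc 2 * Q ^ (f * (m + 4 - 1) + 2 * (m + 4))
          ≤ Q * Q ^ (f * (m + 4 - 1) + 2 * (m + 4)) := Nat.mul_le_mul_right _ hQ2
        _ = Q ^ (f * (m + 4 - 1) + 2 * (m + 4) + 1) := by ring
        _ ≤ _ := Nat.pow_le_pow_right (by omega) (by
            rw [add_mul]; omega)
    rw [mul_assoc] at h3
    omega

end main

/-- for a non-singular cubic form in `n ≥ 4` variables,
`S₀(ϖ^e) ≪ |ϖ|^{e(n-1)}` with constant independent of `q` and `ϖ`. -/
theorem stmt_10 (n : ℕ) (hn : 4 ≤ n) : ∃ C : ℝ, 0 < C ∧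
    ∀ (Fq : Type) [Field Fq] [Fintype Fq], 3 < ringChar Fq →
      ∀ (F : MvPolynomial (Fin n) Fq), F.IsHomogeneous 3 → NonsingularForm F →
        ∀ (ϖ : Polynomial Fq), ϖ.Monic → Irreducible ϖ →
          ∀ e : ℕ, 1 ≤ e →
            (S0 F ϖ e : ℝ)
              ≤ C * ((Fintype.card Fq : ℝ) ^ ϖ.natDegree) ^ (e * (n - 1)) := by
  refine ⟨6, by norm_num, ?_⟩
  intro Fq _ _ _ F hF hN ϖ hm hi e _
  have hF0 : F ≠ 0 := by
    rintro rfl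
    have := hN (fun _ => 1) (fun i => by simp)
    exact one_ne_zero (congrFun this ⟨0, by omega⟩)
  rw [S0_eq]
  exact_mod_cast T0_bound hF hF0 hn hN hm hi e
end
end

section
/- With notation as in the function-field circle method, let ω : K_∞^n → ℝ_{≥0} be the indicator of {x : |tx − b| < 1}, and for monic r̃ ∈ F_q[t], θ ∈ K_∞, c ∈ F_q[t]^n, P = t^{d+1}, define I_{r̃}(θ; c) = ∫_{K_∞^n} ω(u) ψ(θP³F(u) + P c·u / r̃) du. If |c| > q |r̃| |P|^{-1} max{1, |θ||P|³}, then I_{r̃}(θ; c) = 0. -/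
open scoped Classical BigOperators
open MeasureTheory Polynomial

noncomputable section

abbrev Kinf (Fq : Type) [Field Fq] := LaurentSeries Fq

def tvar (Fq : Type) [Field Fq] : Kinf Fq := HahnSeries.single (-1 : ℤ) 1

def absK {Fq : Type} [Field Fq] [Fintype Fq] (f : Kinf Fq) : ℝ :=
  if f = 0 then 0 else (Fintype.card Fq : ℝ) ^ (-(f.order))

def polyK {Fq : Type} [Field Fq] (f : Polynomial Fq) : Kinf Fq :=
  Polynomial.aeval (tvar Fq) f

def psiK {Fq : Type} [Field Fq] [Fintype Fq] [Algebra (ZMod (ringChar Fq)) Fq]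
    (f : Kinf Fq) : ℂ :=
  Complex.exp (2 * Real.pi * Complex.I *
    ((Algebra.trace (ZMod (ringChar Fq)) Fq (f.coeff 1)).val : ℂ) / (ringChar Fq : ℂ))

theorem aux_nm {α : Type*} [MeasurableSpace α] (π : Measure α) [SigmaFinite π] (T : α ≃ α)
    (hT : ∀ s : Set α, π (T ⁻¹' s) = π s) (s : Set α) (hs : MeasurableSet s) :
    NullMeasurableSet (T ⁻¹' s) π := by
  have key : ∀ s : Set α, MeasurableSet s → π s ≠ ⊤ → NullMeasurableSet (T ⁻¹' s) π := by
    intro s hs hfin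
    have hT' : ∀ s : Set α, π (T.symm ⁻¹' s) = π s := fun s => by
      rw [← hT (T.symm ⁻¹' s), ← Set.preimage_comp]; simp
    set H := toMeasurable π (T ⁻¹' s) with hH
    have h1 : T ⁻¹' s ⊆ H := subset_toMeasurable _ _
    have h2 : s ⊆ T.symm ⁻¹' H := by
      intro x hx
      apply h1
      simpa using hx
    have h3 : π (T.symm ⁻¹' H \ s) = 0 := by
      rw [measure_sdiff h2 hs.nullMeasurableSet hfin, hT', hH, measure_toMeasurable, hT, tsub_self]
    have h4 : π (H \ T ⁻¹' s) = 0 := by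
      rw [← hT', Set.preimage_sdiff, ← Set.preimage_comp]
      simpa using h3
    have h5 : T ⁻¹' s = H \ (H \ T ⁻¹' s) := by
      rw [Set.sdiff_sdiff_cancel_left h1]
    rw [h5]
    exact (measurableSet_toMeasurable _ _).nullMeasurableSet.diff (NullMeasurableSet.of_null h4)
  have h : s = ⋃ i, s ∩ spanningSets π i := by
    rw [← Set.inter_iUnion, iUnion_spanningSets, Set.inter_univ]
  rw [h, Set.preimage_iUnion]
  refine NullMeasurableSet.iUnion fun i => key _ (hs.inter (measurableSet_spanningSets π i)) ?_
  exact ((measure_mono Set.inter_subset_right).trans_lt (measure_spanningSets_lt_top π i)).ne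

theorem aux_int {α : Type*} [MeasurableSpace α] (π : Measure α) [SigmaFinite π] (T : α ≃ α)
    (hT : ∀ s : Set α, π (T ⁻¹' s) = π s) (S : Set α) (hS : T ⁻¹' S = S) (f : α → ℂ) (ζ : ℂ)
    (hζ : ζ ≠ 1) (hf : ∀ x ∈ S, f (T x) = ζ * f x) : ∫ x in S, f x ∂π = 0 := by
  by_cases hm : AEStronglyMeasurable f (π.restrict S)
  swap
  · exact integral_non_aestronglyMeasurable hm
  obtain ⟨g, hg, hfg⟩ := hm
  rw [integral_congr_ae hfg]
  have hgm : Measurable g := hg.measurable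
  have hnm : ∀ s, MeasurableSet s → NullMeasurableSet (T ⁻¹' s) (π.restrict S) := fun s hs =>
    (aux_nm π T hT s hs).mono_ac Measure.absolutelyContinuous_restrict
  have hinv : ∀ s, MeasurableSet s → π.restrict S (T ⁻¹' s) = π.restrict S s := by
    intro s hs
    rw [Measure.restrict_apply₀ (hnm s hs), Measure.restrict_apply hs, ← hT (s ∩ S),
      Set.preimage_inter, hS]
  have hgT : AEMeasurable (g ∘ T) (π.restrict S) := by
    apply NullMeasurable.aemeasurable
    intro s hs
    rw [Set.preimage_comp]
    exact hnm _ (hgm hs)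
  have hmap : Measure.map (g ∘ T) (π.restrict S) = Measure.map g (π.restrict S) := by
    ext s hs
    rw [Measure.map_apply_of_aemeasurable hgT hs, Measure.map_apply hgm hs, Set.preimage_comp,
      hinv _ (hgm hs)]
  have e1 : ∫ x, g (T x) ∂(π.restrict S) = ∫ x, g x ∂(π.restrict S) := by
    have a := integral_map (f := fun z : ℂ => z) hgT aestronglyMeasurable_id
    have b := integral_map (f := fun z : ℂ => z) hgm.aemeasurable
      (μ := π.restrict S) aestronglyMeasurable_id
    rw [hmap] at a
    exact a.symm.trans b
  have e2 : (fun x => g (T x)) =ᵐ[π.restrict S] fun x => ζ * g x := by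
    have hD : NullMeasurableSet {x | ¬ (g (T x) = ζ * g x)} (π.restrict S) :=
      (nullMeasurableSet_eq_fun hgT (hgm.const_mul ζ).aemeasurable).compl
    rw [Filter.EventuallyEq, ae_iff, Measure.restrict_apply₀ hD]
    set N := toMeasurable (π.restrict S) {x | ¬ (f x = g x)} with hN
    have hN0 : π (N ∩ S) = 0 := by
      rw [← Measure.restrict_apply (measurableSet_toMeasurable _ _), measure_toMeasurable]
      exact ae_iff.1 hfg
    have hN1 : π (T ⁻¹' (N ∩ S)) = 0 := by rw [hT, hN0]
    refine measure_mono_null ?_ (measure_union_null hN0 hN1)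
    rintro x ⟨hx, hxS⟩
    by_contra hcon
    simp only [Set.mem_union, not_or] at hcon
    have hTS : T x ∈ S := by rw [← hS] at hxS; exact hxS
    have q1 : f x = g x := by
      by_contra h
      exact hcon.1 ⟨subset_toMeasurable _ _ h, hxS⟩
    have q2 : f (T x) = g (T x) := by
      by_contra h
      exact hcon.2 ⟨subset_toMeasurable _ _ h, hTS⟩
    exact hx (by rw [← q1, ← q2, hf x hxS])
  rw [integral_congr_ae e2, integral_const_mul] at e1
  have : (ζ - 1) * ∫ x, g x ∂(π.restrict S) = 0 := by linear_combination e1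
  exact (mul_eq_zero.1 this).resolve_left (sub_ne_zero.2 hζ)

theorem aux_pi_le {K : Type*} [AddCommGroup K] [MeasurableSpace K] (μ : Measure K) [SigmaFinite μ]
    (hinv : ∀ a : K, ∀ s : Set K, μ ((a + ·) ⁻¹' s) = μ s) {n : ℕ} (h : Fin n → K)
    (s : Set (Fin n → K)) :
    Measure.pi (fun _ : Fin n => μ) ((h + ·) ⁻¹' s) ≤ Measure.pi (fun _ : Fin n => μ) s := by
  have h1 : OuterMeasure.map (h + ·) (Measure.pi (fun _ : Fin n => μ)).toOuterMeasure ≤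
      OuterMeasure.pi (fun _ : Fin n => μ.toOuterMeasure) := by
    rw [OuterMeasure.le_pi]
    intro t _
    have : (h + ·) ⁻¹' (Set.univ.pi t) = Set.univ.pi fun i => (h i + ·) ⁻¹' (t i) := by
      ext x; simp [Set.mem_pi]
    simp only [OuterMeasure.map_apply, this, Measure.coe_toOuterMeasure, Measure.pi_pi, hinv]
    exact le_rfl
  rw [← measure_toMeasurable s]
  refine (measure_mono (Set.preimage_mono (subset_toMeasurable
    (Measure.pi (fun _ : Fin n => μ)) s))).trans ((h1 (toMeasurable (Measure.pi (fun _ : Fin n => μ)) s)).trans ?_)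
  generalize toMeasurable (Measure.pi (fun _ : Fin n => μ)) s = H
  rw [Measure.pi]
  exact le_toMeasure_apply (OuterMeasure.pi (fun _ : Fin n => μ.toOuterMeasure)) (Measure.pi_caratheodory _) _

theorem aux_pi {K : Type*} [AddCommGroup K] [MeasurableSpace K] (μ : Measure K) [SigmaFinite μ]
    (hinv : ∀ a : K, ∀ s : Set K, μ ((a + ·) ⁻¹' s) = μ s) {n : ℕ} (h : Fin n → K)
    (s : Set (Fin n → K)) :
    Measure.pi (fun _ : Fin n => μ) ((Equiv.addLeft h) ⁻¹' s)
      = Measure.pi (fun _ : Fin n => μ) s := by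
  refine le_antisymm (aux_pi_le μ hinv h s) ?_
  have := aux_pi_le μ hinv (-h) ((h + ·) ⁻¹' s)
  rw [← Set.preimage_comp] at this
  have e : ((fun x => h + x) ∘ fun x => -h + x) = id := by ext x; simp
  rw [e] at this
  exact this

abbrev vK {Fq : Type} [Field Fq] : AddValuation (Kinf Fq) (WithTop ℤ) := HahnSeries.addVal ℤ Fq

theorem algMap_eq {Fq : Type} [Field Fq] (a : Fq) :
    algebraMap Fq (Kinf Fq) a = HahnSeries.single (0 : ℤ) a := by
  rw [HahnSeries.algebraMap_apply', PowerSeries.algebraMap_apply]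
  simp

theorem aux_poly {Fq : Type} [Field Fq] {n : ℕ} (u u' : Fin n → Kinf Fq) (k : ℤ)
    (hu : ∀ i, (0 : WithTop ℤ) ≤ vK (u i)) (hu' : ∀ i, (0 : WithTop ℤ) ≤ vK (u' i))
    (hd : ∀ i, (k : WithTop ℤ) ≤ vK (u' i - u i)) (F : MvPolynomial (Fin n) Fq) :
    (0 : WithTop ℤ) ≤ vK (MvPolynomial.aeval u F) ∧
    (0 : WithTop ℤ) ≤ vK (MvPolynomial.aeval u' F) ∧
    (k : WithTop ℤ) ≤ vK (MvPolynomial.aeval u' F - MvPolynomial.aeval u F) := by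
  induction F using MvPolynomial.induction_on with
  | C a =>
    have : (0 : WithTop ℤ) ≤ vK (algebraMap Fq (Kinf Fq) a) := by
      rw [HahnSeries.addVal_apply, HahnSeries.le_orderTop_iff_forall]
      intro j hj
      have hj' : j < 0 := by exact_mod_cast hj
      rw [algMap_eq, HahnSeries.coeff_single_of_ne hj'.ne]
    simp [this]
  | add p q hp hq =>
    simp only [map_add]
    refine ⟨vK.map_le_add hp.1 hq.1, vK.map_le_add hp.2.1 hq.2.1, ?_⟩
    rw [add_sub_add_comm]
    exact vK.map_le_add hp.2.2 hq.2.2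
  | mul_X p i hp =>
    simp only [map_mul, MvPolynomial.aeval_X]
    refine ⟨?_, ?_, ?_⟩
    · rw [AddValuation.map_mul]; exact add_nonneg hp.1 (hu i)
    · rw [AddValuation.map_mul]; exact add_nonneg hp.2.1 (hu' i)
    · have : MvPolynomial.aeval u' p * u' i - MvPolynomial.aeval u p * u i =
        MvPolynomial.aeval u' p * (u' i - u i) + (MvPolynomial.aeval u' p - MvPolynomial.aeval u p) * u i := by ring
      rw [this]
      apply vK.map_le_add
      · rw [AddValuation.map_mul]; exact le_add_of_nonneg_of_le hp.2.1 (hd i)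
      · rw [AddValuation.map_mul]; exact le_add_of_le_of_nonneg hp.2.2 (hu i)

theorem aux_coeff_zero {Fq : Type} [Field Fq] {x : Kinf Fq} {k j : ℤ}
    (h : (k : WithTop ℤ) ≤ vK x) (hj : j < k) : x.coeff j = 0 := by
  apply HahnSeries.coeff_eq_zero_of_lt_orderTop
  rw [← HahnSeries.addVal_apply]
  exact lt_of_lt_of_le (by exact_mod_cast hj) h

theorem polyK_coeff {Fq : Type} [Field Fq] (f : Polynomial Fq) (k : ℕ) :
    (polyK f).coeff (-(k : ℤ)) = f.coeff k := by
  induction f using Polynomial.induction_on' with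
  | add p q hp hq => simp only [polyK, map_add, HahnSeries.coeff_add, Polynomial.coeff_add] at *; rw [hp, hq]
  | monomial m a =>
    simp only [polyK, tvar, Polynomial.aeval_monomial, HahnSeries.single_pow, one_pow,
      algMap_eq, HahnSeries.single_mul_single,
      Polynomial.coeff_monomial, HahnSeries.coeff_single]
    simp [eq_comm]

theorem polyK_ne {Fq : Type} [Field Fq] {f : Polynomial Fq} (hf : f ≠ 0) : polyK f ≠ 0 := by
  intro h
  apply hf
  ext k
  rw [← polyK_coeff, h]
  simp

theorem absK_lt_one {Fq : Type} [Field Fq] [Fintype Fq] (x : Kinf Fq) :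
    absK x < 1 ↔ (1 : WithTop ℤ) ≤ vK x := by
  unfold absK
  have hq : (1 : ℝ) < Fintype.card Fq := by exact_mod_cast Fintype.one_lt_card
  split_ifs with h
  · simp [h]
  · rw [HahnSeries.addVal_apply_of_ne h, zpow_lt_one_iff_right₀ hq]
    norm_cast
    omega

theorem psiK_eq {Fq : Type} [Field Fq] [Fintype Fq] [Algebra (ZMod (ringChar Fq)) Fq]
    [NeZero (ringChar Fq)] (f : Kinf Fq) :
    psiK f = ZMod.toCircle (Algebra.trace (ZMod (ringChar Fq)) Fq (f.coeff 1)) := by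
  rw [ZMod.toCircle_apply, psiK]

theorem neZero_char {Fq : Type} [Field Fq] [Fintype Fq] : NeZero (ringChar Fq) :=
  ⟨CharP.ringChar_ne_zero_of_finite Fq⟩

theorem psiK_add {Fq : Type} [Field Fq] [Fintype Fq] [Algebra (ZMod (ringChar Fq)) Fq]
    (f g : Kinf Fq) : psiK (f + g) = psiK f * psiK g := by
  have := neZero_char (Fq := Fq)
  rw [psiK_eq, psiK_eq, psiK_eq, HahnSeries.coeff_add, map_add, AddChar.map_add_eq_mul]
  simp

theorem psiK_of_coeff {Fq : Type} [Field Fq] [Fintype Fq] [Algebra (ZMod (ringChar Fq)) Fq]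
    (f : Kinf Fq) (h : f.coeff 1 = 0) : psiK f = 1 := by
  have := neZero_char (Fq := Fq)
  rw [psiK_eq, h]; simp

theorem psiK_nontriv {Fq : Type} [Field Fq] [Fintype Fq] [Algebra (ZMod (ringChar Fq)) Fq] :
    ∃ a : Fq, a ≠ 0 ∧ ∀ f : Kinf Fq, f.coeff 1 = a → psiK f ≠ 1 := by
  have := neZero_char (Fq := Fq)
  have hp : Fact (ringChar Fq).Prime := ⟨CharP.char_prime_of_ne_zero Fq this.out⟩
  have hne := Algebra.trace_ne_zero (ZMod (ringChar Fq)) Fq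
  obtain ⟨a, ha⟩ : ∃ a, Algebra.trace (ZMod (ringChar Fq)) Fq a ≠ 0 := by
    by_contra hc
    push Not at hc
    exact hne (LinearMap.ext hc)
  refine ⟨a, fun h => ha (by simp [h]), fun f hf h => ha ?_⟩
  rw [psiK_eq, hf] at h
  apply ZMod.injective_toCircle
  rw [AddChar.map_zero_eq_one]
  exact Circle.ext h

/-- the oscillatory integral `I_{r̃}(θ; c)` vanishes as soon as
`|c| > q |r̃| |P|⁻¹ max{1, |θ||P|³}`, where `P = t^{d+1}`. -/
theorem stmt_15 {Fq : Type} [Field Fq] [Fintype Fq] [Algebra (ZMod (ringChar Fq)) Fq]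
    [MeasurableSpace (Kinf Fq)] (μ : Measure (Kinf Fq)) [SigmaFinite μ]
    (hinv : ∀ a : Kinf Fq, ∀ s : Set (Kinf Fq), μ ((a + ·) ⁻¹' s) = μ s)
    (hball : ∀ N : ℤ, μ {α : Kinf Fq | absK α < (Fintype.card Fq : ℝ) ^ N}
        = ENNReal.ofReal ((Fintype.card Fq : ℝ) ^ N))
    (hchar : 3 < ringChar Fq)
    {n d : ℕ} (hd : 1 ≤ d) (F : MvPolynomial (Fin n) Fq) (hF : F.IsHomogeneous 3)
    (b : Fin n → Fq) (rt : Polynomial Fq) (hrt : rt.Monic)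
    (θ : Kinf Fq) (c : Fin n → Polynomial Fq)
    (hc : ∃ i, absK (polyK (c i)) >
        (Fintype.card Fq : ℝ) * absK (polyK rt) * (Fintype.card Fq : ℝ) ^ (-(d + 1 : ℤ))
          * max 1 (absK θ * (Fintype.card Fq : ℝ) ^ (3 * (d + 1)))) :
    (∫ u in {u : Fin n → Kinf Fq |
        ∀ i, absK (tvar Fq * u i - algebraMap Fq (Kinf Fq) (b i)) < 1},
      psiK (θ * (tvar Fq) ^ (3 * (d + 1)) * MvPolynomial.aeval u F
        + (tvar Fq) ^ (d + 1) * (∑ i, polyK (c i) * u i) * (polyK rt)⁻¹)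
      ∂(MeasureTheory.Measure.pi fun _ : Fin n => μ)) = 0 := by
  
  obtain ⟨i, hi⟩ := hc
  have hq : (1 : ℝ) < Fintype.card Fq := by exact_mod_cast Fintype.one_lt_card
  have hq0 : (0 : ℝ) < Fintype.card Fq := by linarith
  have hr : polyK rt ≠ 0 := polyK_ne hrt.ne_zero
  have habsr : absK (polyK rt) = (Fintype.card Fq : ℝ) ^ (-(polyK rt).order) := by
    rw [absK, if_neg hr]
  have hc0 : polyK (c i) ≠ 0 := by
    intro h
    rw [absK, if_pos h, habsr] at hi
    exact absurd hi (not_lt.2 (by positivity))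
  have habsc : absK (polyK (c i)) = (Fintype.card Fq : ℝ) ^ (-(polyK (c i)).order) := by
    rw [absK, if_neg hc0]
  have ht0 : tvar Fq ≠ 0 := by
    simp [tvar]
  have hvt : vK (tvar Fq) = ((-1 : ℤ) : WithTop ℤ) := by
    rw [HahnSeries.addVal_apply_of_ne ht0, tvar, HahnSeries.order_single one_ne_zero]
  have hvtp : ∀ k : ℕ, vK (tvar Fq ^ k) = ((-(k : ℤ) : ℤ) : WithTop ℤ) := by
    intro k
    rw [tvar, HahnSeries.single_pow, HahnSeries.addVal_apply, one_pow,
      HahnSeries.orderTop_single one_ne_zero]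
    simp
  set w : Kinf Fq := tvar Fq ^ (d + 1) * polyK (c i) * (polyK rt)⁻¹ with hw
  have hw0 : w ≠ 0 := mul_ne_zero (mul_ne_zero (pow_ne_zero _ ht0) hc0) (inv_ne_zero hr)
  have hword : w.order + (polyK rt).order = -(d + 1 : ℤ) + (polyK (c i)).order := by
    have e : w * polyK rt = tvar Fq ^ (d + 1) * polyK (c i) := by
      rw [hw, inv_mul_cancel_right₀ hr]
    have e2 := congrArg (vK (Fq := Fq)) e
    rw [vK.map_mul w, vK.map_mul (_ ^ _), hvtp, HahnSeries.addVal_apply_of_ne hw0,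
      HahnSeries.addVal_apply_of_ne hr, HahnSeries.addVal_apply_of_ne hc0] at e2
    exact_mod_cast e2
  have hbase : ∀ m : ℤ, (Fintype.card Fq : ℝ) ^ m ≤
      max 1 (absK θ * (Fintype.card Fq : ℝ) ^ (3 * (d + 1))) → m + 1 < -w.order := by
    intro m hm
    have h1 : (Fintype.card Fq : ℝ) ^ (1 - (polyK rt).order - (d + 1) + m : ℤ) <
        (Fintype.card Fq : ℝ) ^ (-(polyK (c i)).order) := by
      rw [← habsc]
      refine lt_of_le_of_lt ?_ hi
      rw [habsr, zpow_add₀ hq0.ne', sub_eq_add_neg, sub_eq_add_neg, zpow_add₀ hq0.ne',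
        zpow_add₀ hq0.ne', zpow_one]
      gcongr
    have h2 := (zpow_lt_zpow_iff_right₀ hq).1 h1
    omega
  have hw1 : w.order ≤ -2 := by
    have := hbase 0 (by simp)
    omega
  obtain ⟨a, ha0, ha⟩ := psiK_nontriv (Fq := Fq)
  have hl0 : w.leadingCoeff ≠ 0 := HahnSeries.leadingCoeff_ne_zero.2 hw0
  set z : Kinf Fq := HahnSeries.single (1 - w.order) (w.leadingCoeff⁻¹ * a) with hz
  have hvz : vK z = ((1 - w.order : ℤ) : WithTop ℤ) := by
    rw [hz, HahnSeries.addVal_apply,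
      HahnSeries.orderTop_single (mul_ne_zero (inv_ne_zero hl0) ha0)]
  have hwz : (w * z).coeff 1 = a := by
    rw [hz, HahnSeries.coeff_mul_single, sub_sub_cancel, ← HahnSeries.leadingCoeff_eq,
      mul_inv_cancel_left₀ hl0]
  set h : Fin n → Kinf Fq := Pi.single i z with hh
  have hvh : ∀ j, ((1 - w.order : ℤ) : WithTop ℤ) ≤ vK (h j) := by
    intro j
    by_cases hj : j = i
    · subst hj; rw [hh, Pi.single_eq_same, hvz]
    · rw [hh, Pi.single_eq_of_ne hj]; simp
  -- membership in the support
  have hmem : ∀ u : Fin n → Kinf Fq,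
      (∀ j, absK (tvar Fq * u j - algebraMap Fq (Kinf Fq) (b j)) < 1) →
      ∀ j, (1 : WithTop ℤ) ≤ vK (u j) := by
    intro u hu j
    have h1 := (absK_lt_one _).1 (hu j)
    have h2 : (0 : WithTop ℤ) ≤ vK (algebraMap Fq (Kinf Fq) (b j)) := by
      simpa using (aux_poly (Fq := Fq) (n := 0) (fun _ => 0) (fun _ => 0) 0 (by simp) (by simp)
        (by simp) (MvPolynomial.C (b j))).1
    have h3 : (0 : WithTop ℤ) ≤ vK (tvar Fq * u j) := by
      rw [← sub_add_cancel (tvar Fq * u j) (algebraMap Fq (Kinf Fq) (b j))]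
      exact vK.map_le_add (le_trans zero_le_one h1) h2
    rw [AddValuation.map_mul, hvt] at h3
    rcases hvu : vK (u j) with _ | m
    · exact le_top
    · rw [hvu] at h3
      have h3' : (0 : WithTop ℤ) ≤ ((-1 + m : ℤ) : WithTop ℤ) := h3
      have h4 : (0 : ℤ) ≤ -1 + m := by exact_mod_cast h3'
      have h5 : (1 : ℤ) ≤ m := by omega
      exact WithTop.coe_le_coe.2 h5
  have hth : ∀ j, (1 : WithTop ℤ) ≤ vK (tvar Fq * h j) := by
    intro j
    rw [AddValuation.map_mul, hvt]
    refine le_trans ?_ (add_le_add_right (hvh j) _)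
    norm_cast
    omega
  have hSiff : ∀ u : Fin n → Kinf Fq,
      (∀ j, absK (tvar Fq * (h + u) j - algebraMap Fq (Kinf Fq) (b j)) < 1) ↔
      (∀ j, absK (tvar Fq * u j - algebraMap Fq (Kinf Fq) (b j)) < 1) := by
    intro u
    refine forall_congr' fun j => ?_
    rw [absK_lt_one, absK_lt_one]
    have e : tvar Fq * (h + u) j - algebraMap Fq (Kinf Fq) (b j) =
      tvar Fq * h j + (tvar Fq * u j - algebraMap Fq (Kinf Fq) (b j)) := by
      simp only [Pi.add_apply]; ring
    rw [e]
    constructor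
    · intro hx
      have := vK.map_le_sub hx (hth j)
      simpa using this
    · intro hx
      exact vK.map_le_add (hth j) hx
  refine aux_int _ (Equiv.addLeft h) (fun s => aux_pi μ hinv h s) _ ?_ _ (psiK (w * z))
    (ha _ hwz) ?_
  · ext u
    exact hSiff u
  · intro u hu
    have hu1 := hmem u hu
    have hu2 := hmem (h + u) ((hSiff u).2 hu)
    have hF := (aux_poly u (h + u) (1 - w.order) (fun j => le_trans zero_le_one (hu1 j))
      (fun j => le_trans zero_le_one (hu2 j)) (fun j => by simpa using hvh j) F).2.2
    set D := MvPolynomial.aeval (h + u) F - MvPolynomial.aeval u F with hD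
    have hsum : ∑ j, polyK (c j) * (h + u) j = polyK (c i) * z + ∑ j, polyK (c j) * u j := by
      simp only [Pi.add_apply, mul_add, Finset.sum_add_distrib]
      congr 1
      rw [Finset.sum_eq_single i]
      · rw [hh, Pi.single_eq_same]
      · intro j _ hj
        rw [hh, Pi.single_eq_of_ne hj, mul_zero]
      · simp
    have e : θ * (tvar Fq) ^ (3 * (d + 1)) * MvPolynomial.aeval (h + u) F
        + (tvar Fq) ^ (d + 1) * (∑ j, polyK (c j) * (h + u) j) * (polyK rt)⁻¹ =
        w * z + (θ * (tvar Fq) ^ (3 * (d + 1)) * D +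
        (θ * (tvar Fq) ^ (3 * (d + 1)) * MvPolynomial.aeval u F
        + (tvar Fq) ^ (d + 1) * (∑ j, polyK (c j) * u j) * (polyK rt)⁻¹)) := by
      rw [hsum, hD, hw]; ring
    have hDz : (θ * (tvar Fq) ^ (3 * (d + 1)) * D).coeff 1 = 0 := by
      by_cases hθ : θ = 0
      · simp [hθ]
      · have hb := hbase (-θ.order + (3 * (d + 1) : ℕ)) (by
          refine le_trans (le_of_eq ?_) (le_max_right _ _)
          rw [absK, if_neg hθ, zpow_add₀ hq0.ne', zpow_natCast])
        apply aux_coeff_zero (k := θ.order + -((3 * (d + 1) : ℕ) : ℤ) + (1 - w.order))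
        · rw [AddValuation.map_mul, AddValuation.map_mul, hvtp,
            HahnSeries.addVal_apply_of_ne hθ, WithTop.coe_add, WithTop.coe_add]
          exact add_le_add_right hF _
        · omega
    change psiK (θ * (tvar Fq) ^ (3 * (d + 1)) * MvPolynomial.aeval (h + u) F
        + (tvar Fq) ^ (d + 1) * (∑ j, polyK (c j) * (h + u) j) * (polyK rt)⁻¹) = _
    rw [e, psiK_add, psiK_add (θ * (tvar Fq) ^ (3 * (d + 1)) * D), psiK_of_coeff _ hDz, one_mul]
end
end

section
/- Let F be a non-singular cubic form over F_q with char(F_q) > 3, n ≥ 10 variables, and b ∈ F_q^n with F(b) = 0 and Hessian determinant H(b) ≠ 0. With I_{r̃}(θ; c) the oscillatory integral defined with weight ω equal to the indicator of {x ∈ K_∞^n : |tx − b| < 1}, one has |I_{r̃}(θ; c)| ≪ min{q^{-n}, q^n |θP³|^{-n/2}}, with implied constant independent of q. -/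
open scoped Classical BigOperators
open MeasureTheory Polynomial

noncomputable section

/-- The determinant of the Hessian matrix of a multivariate polynomial. -/
def hessianDet {Fq : Type} [Field Fq] {n : ℕ} (F : MvPolynomial (Fin n) Fq) :
    MvPolynomial (Fin n) Fq :=
  Matrix.det (Matrix.of fun i j => MvPolynomial.pderiv i (MvPolynomial.pderiv j F))


namespace S16

variable {Fq : Type} [Field Fq]

/-- The embedding of power series in Laurent series. -/
abbrev ofP {Fq : Type} [Field Fq] : PowerSeries Fq →+* Kinf Fq := HahnSeries.ofPowerSeries ℤ Fq

/-- The power of the uniformizer. -/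
def xp (Fq : Type) [Field Fq] (s : ℤ) : Kinf Fq := HahnSeries.single s 1

lemma xp_mul (s t : ℤ) : xp Fq s * xp Fq t = xp Fq (s + t) := by
  simp [xp]

lemma xp_zero : xp Fq 0 = 1 := rfl

lemma xp_ne (s : ℤ) : xp Fq s ≠ 0 := by simp [xp]

lemma xp_nat (k : ℕ) : ofP (PowerSeries.X ^ k : PowerSeries Fq) = xp Fq k := by
  simp [xp, ofP]

lemma xp_one : ofP (PowerSeries.X : PowerSeries Fq) = xp Fq 1 := by
  simp [xp, ofP]

lemma tvar_eq : tvar Fq = xp Fq (-1) := rfl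

lemma tvar_pow (k : ℕ) : tvar Fq ^ k = xp Fq (-k) := by
  simp [tvar, xp]

lemma coeff_xp_mul (s j : ℤ) (f : Kinf Fq) : (xp Fq s * f).coeff j = f.coeff (j - s) := by
  simp [xp, HahnSeries.coeff_single_mul]

lemma coeff_ofP_nat (g : PowerSeries Fq) (j : ℕ) : (ofP g).coeff (j : ℤ) = PowerSeries.coeff j g :=
  HahnSeries.ofPowerSeries_apply_coeff g j

lemma coeff_ofP_neg (g : PowerSeries Fq) (j : ℤ) (hj : j < 0) : (ofP g).coeff j = 0 := by
  have := LaurentSeries.coeff_coe_powerSeries g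
  rw [PowerSeries.coeff_coe]
  simp [hj]

/-- Fractional ideals. -/
def L (Fq : Type) [Field Fq] (s : ℤ) : AddSubgroup (Kinf Fq) where
  carrier := {f | ∀ j < s, f.coeff j = 0}
  zero_mem' := by intro j _; simp
  add_mem' := by intro a b ha hb j hj; simp [ha j hj, hb j hj]
  neg_mem' := by intro a ha j hj; simp [ha j hj]

lemma mem_L {s : ℤ} {f : Kinf Fq} : f ∈ L Fq s ↔ ∀ j < s, f.coeff j = 0 := Iff.rfl

lemma xp_mul_mem {s t : ℤ} {f : Kinf Fq} : xp Fq s * f ∈ L Fq t ↔ f ∈ L Fq (t - s) := by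
  simp only [mem_L, coeff_xp_mul]
  constructor
  · intro h j hj
    have := h (j + s) (by omega)
    simpa using this
  · intro h j hj
    exact h _ (by omega)

lemma ofP_mem (g : PowerSeries Fq) : ofP g ∈ L Fq 0 := fun j hj => coeff_ofP_neg g j hj

lemma L_mono {s t : ℤ} (h : s ≤ t) {f : Kinf Fq} (hf : f ∈ L Fq t) : f ∈ L Fq s :=
  fun j hj => hf j (by omega)

lemma mem_L_iff {s : ℤ} {f : Kinf Fq} : f ∈ L Fq s ↔ ∃ g : PowerSeries Fq, f = xp Fq s * ofP g := by
  constructor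
  · intro h
    refine ⟨PowerSeries.mk fun i => f.coeff (s + i), ?_⟩
    ext j
    rw [coeff_xp_mul]
    by_cases hj : j < s
    · rw [h j hj, coeff_ofP_neg _ _ (by omega)]
    · obtain ⟨i, hi⟩ : ∃ i : ℕ, j - s = i := ⟨(j - s).toNat, by omega⟩
      rw [hi, coeff_ofP_nat, PowerSeries.coeff_mk]
      congr 1; omega
  · rintro ⟨g, rfl⟩
    rw [xp_mul_mem]; simpa using ofP_mem g

lemma L_mul {s t : ℤ} {f g : Kinf Fq} (hf : f ∈ L Fq s) (hg : g ∈ L Fq t) : f * g ∈ L Fq (s + t) := by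
  obtain ⟨a, rfl⟩ := mem_L_iff.1 hf
  obtain ⟨c, rfl⟩ := mem_L_iff.1 hg
  refine mem_L_iff.2 ⟨a * c, ?_⟩
  rw [map_mul, ← xp_mul]; ring

lemma L_mul_ofP {s : ℤ} {f : Kinf Fq} (hf : f ∈ L Fq s) (g : PowerSeries Fq) : f * ofP g ∈ L Fq s := by
  simpa using L_mul hf (ofP_mem g)

lemma exists_mem_L (f : Kinf Fq) : ∃ s : ℤ, f ∈ L Fq s := ⟨f.order, fun _ hj =>
  HahnSeries.coeff_eq_zero_of_lt_order hj⟩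

lemma absK_lt [Fintype Fq] (f : Kinf Fq) (N : ℤ) :
    absK f < (Fintype.card Fq : ℝ) ^ N ↔ f ∈ L Fq (1 - N) := by
  have hq : (1 : ℝ) < Fintype.card Fq := by exact_mod_cast Fintype.one_lt_card
  unfold absK
  split_ifs with h
  · subst h
    simp only [zero_mem, iff_true]; positivity
  · rw [zpow_lt_zpow_iff_right₀ hq, mem_L]
    rw [← HahnSeries.le_order_iff_forall h]
    omega

lemma ofP_mem_nat {g : PowerSeries Fq} {k : ℕ} (h : ofP g ∈ L Fq k) : ∃ r, g = PowerSeries.X ^ k * r := by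
  have : PowerSeries.X ^ k ∣ g := by
    rw [PowerSeries.X_pow_dvd_iff]
    intro m hm
    have := h m (by omega)
    rwa [coeff_ofP_nat] at this
  exact this

lemma algebraMap_eq (c : Fq) : algebraMap Fq (Kinf Fq) c = ofP (PowerSeries.C c) := rfl

lemma aeval_ofP {n : ℕ} (F : MvPolynomial (Fin n) Fq) (z : Fin n → PowerSeries Fq) :
    MvPolynomial.aeval (fun i => ofP (z i)) F = ofP (MvPolynomial.aeval z F) := by
  rw [MvPolynomial.aeval_def, MvPolynomial.aeval_def, MvPolynomial.hom_eval₂]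
  congr 1

lemma aeval_smul_hom {n k : ℕ} {S : Type*} [CommRing S] [Algebra Fq S] (F : MvPolynomial (Fin n) Fq)
    (hF : F.IsHomogeneous k) (s : S) (z : Fin n → S) :
    MvPolynomial.aeval (fun i => s * z i) F = s ^ k * MvPolynomial.aeval z F := by
  rw [MvPolynomial.aeval_def, MvPolynomial.aeval_def, MvPolynomial.eval₂_eq, MvPolynomial.eval₂_eq,
    Finset.mul_sum]
  refine Finset.sum_congr rfl fun d hd => ?_
  have h1 : ∑ i, d i = k := by
    have := hF (MvPolynomial.mem_support_iff.1 hd)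
    rw [← this, Finsupp.weight_apply, Finsupp.sum_fintype] <;> simp
  have h2 : ∏ i ∈ d.support, (s * z i) ^ d i = s ^ k * ∏ i ∈ d.support, z i ^ d i := by
    simp_rw [mul_pow]
    rw [Finset.prod_mul_distrib, Finset.prod_pow_eq_pow_sum]
    congr 2
    rw [← h1]
    exact Finset.sum_subset (Finset.subset_univ _) (by intro i _ hi; simpa using hi)
  rw [h2]; ring

lemma taylor {n : ℕ} {S : Type*} [CommRing S] [Algebra Fq S] (F : MvPolynomial (Fin n) Fq)
    (s : S) (z h : Fin n → S) : ∃ r : S,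
    MvPolynomial.aeval (fun i => z i + s * h i) F = MvPolynomial.aeval z F
      + s * ∑ i, h i * MvPolynomial.aeval z (MvPolynomial.pderiv i F) + s ^ 2 * r := by
  induction F using MvPolynomial.induction_on with
  | C a => exact ⟨0, by simp⟩
  | add p q hp hq =>
    obtain ⟨r, hr⟩ := hp
    obtain ⟨r', hr'⟩ := hq
    refine ⟨r + r', ?_⟩
    simp only [map_add, hr, hr', mul_add, Finset.sum_add_distrib]
    ring
  | mul_X p j hp =>
    obtain ⟨r, hr⟩ := hp
    set D := ∑ i, h i * MvPolynomial.aeval z (MvPolynomial.pderiv i p) with hD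
    refine ⟨r * (z j + s * h j) + D * h j, ?_⟩
    have : ∑ i, h i * MvPolynomial.aeval z (MvPolynomial.pderiv i (p * MvPolynomial.X j))
        = D * z j + h j * MvPolynomial.aeval z p := by
      simp only [MvPolynomial.pderiv_mul, map_add, map_mul, MvPolynomial.aeval_X, mul_add,
        Finset.sum_add_distrib, MvPolynomial.pderiv_X, hD, Finset.sum_mul]
      congr 1
      · exact Finset.sum_congr rfl fun i _ => by ring
      · rw [Finset.sum_eq_single j]
        · simp
        · intro i _ hij; simp [hij.symm]
        · simp
    rw [this]
    simp only [map_mul, MvPolynomial.aeval_X, hr]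
    ring

section psi
variable [Fintype Fq] [Algebra (ZMod (ringChar Fq)) Fq]

lemma psi_eq [NeZero (ringChar Fq)] (f : Kinf Fq) :
    psiK f = ZMod.stdAddChar (Algebra.trace (ZMod (ringChar Fq)) Fq (f.coeff 1)) := by
  rw [psiK, ZMod.stdAddChar_apply, ZMod.toCircle_apply]

lemma psi_add [NeZero (ringChar Fq)] (f g : Kinf Fq) : psiK (f + g) = psiK f * psiK g := by
  simp only [psi_eq, HahnSeries.coeff_add, map_add, AddChar.map_add_eq_mul]

lemma psi_norm [NeZero (ringChar Fq)] (f : Kinf Fq) : ‖psiK f‖ = 1 := by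
  rw [psi_eq, ZMod.stdAddChar_apply]; exact Circle.norm_coe _

lemma psi_L [NeZero (ringChar Fq)] {f : Kinf Fq} (hf : f ∈ L Fq 2) : psiK f = 1 := by
  rw [psi_eq, hf 1 (by norm_num)]; simp

lemma psi_congr [NeZero (ringChar Fq)] {f g : Kinf Fq} (hf : f - g ∈ L Fq 2) : psiK f = psiK g := by
  have : f = g + (f - g) := by ring
  rw [this, psi_add, psi_L hf, mul_one]

lemma psi_exists [Fact (ringChar Fq).Prime] {c : Kinf Fq} (hc : c ∉ L Fq 2) :
    ∃ y : PowerSeries Fq, psiK (c * ofP y) ≠ 1 := by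
  simp only [mem_L, not_forall] at hc
  obtain ⟨j, hj, hcj⟩ := hc
  obtain ⟨k, hk⟩ : ∃ k : ℕ, (k : ℤ) = 1 - j := ⟨(1 - j).toNat, by omega⟩
  obtain ⟨a, ha⟩ := Algebra.trace_surjective (ZMod (ringChar Fq)) Fq 1
  refine ⟨PowerSeries.X ^ k * PowerSeries.C (a / c.coeff j), ?_⟩
  have h1 : (c * ofP (PowerSeries.X ^ k * PowerSeries.C (a / c.coeff j))).coeff 1 = a := by
    rw [map_mul, xp_nat, mul_left_comm, coeff_xp_mul, hk, ofP, HahnSeries.ofPowerSeries_C, mul_comm,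
      HahnSeries.C_mul_eq_smul, HahnSeries.coeff_smul]
    simp [hcj]
  rw [psi_eq, h1, ha]
  intro h
  have h2 := ZMod.injective_stdAddChar (N := ringChar Fq) (a₁ := 1) (a₂ := 0) (by simpa using h)
  exact one_ne_zero h2

end psi

lemma abstract_sum {W : Type*} [AddCommGroup W] [Fintype W] (Y Z : AddSubgroup W) (g : W → ℂ)
    (hg : ∀ w, ‖g w‖ ≤ 1) (good : W → Prop)
    (hbad : ∀ w, ¬ good w → ∃ y0 ∈ Y, ∃ ζ : ℂ, ζ ≠ 1 ∧ ∀ y ∈ Y, g (w + y + y0) = ζ * g (w + y))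
    (hgood : ∀ w w', good w → good w' → w - w' ∈ Z) :
    ‖∑ w, g w‖ ≤ Nat.card Z := by
  have hz : ∀ w, ¬ good w → ∑ y : Y, g (w + y) = 0 := by
    intro w hw
    obtain ⟨y0, hy0, ζ, hζ, h⟩ := hbad w hw
    have h1 : ∑ y : Y, g (w + y) = ζ * ∑ y : Y, g (w + y) := by
      rw [Finset.mul_sum]
      rw [← Equiv.sum_comp (Equiv.addRight (⟨y0, hy0⟩ : Y))]
      refine Finset.sum_congr rfl fun y _ => ?_
      rw [← h y y.2]
      simp [add_assoc]
    have h2 : (1 - ζ) * ∑ y : Y, g (w + y) = 0 := by linear_combination h1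
    rcases mul_eq_zero.1 h2 with h3 | h3
    · exact absurd (by linear_combination -h3) hζ
    · exact h3
  have hcard : (Fintype.card Y : ℂ) * ∑ w, g w = ∑ w, ∑ y : Y, g (w + y) := by
    rw [Finset.sum_comm]
    have : ∀ y : Y, ∑ w, g (w + y) = ∑ w, g w := fun y => Equiv.sum_comp (Equiv.addRight (y : W)) g
    simp [this]
  have hgc : ((Finset.univ.filter good).card : ℝ) ≤ Nat.card Z := by
    by_cases hne : ∃ w0, good w0
    · obtain ⟨w0, h0⟩ := hne
      rw [Nat.card_eq_fintype_card, ← Finset.card_univ (α := Z)]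
      norm_cast
      have : (Finset.univ.filter good) ⊆ (Finset.univ : Finset Z).image (fun z : Z => (z : W) + w0) := by
        intro w hw
        simp only [Finset.mem_filter, Finset.mem_univ, true_and] at hw
        refine Finset.mem_image.2 ⟨⟨w - w0, hgood w w0 hw h0⟩, Finset.mem_univ _, by simp⟩
      exact (Finset.card_le_card this).trans Finset.card_image_le
    · push Not at hne
      simp [hne]
  have hY : (0 : ℝ) < Fintype.card Y := by exact_mod_cast Fintype.card_pos
  have h3 : (Fintype.card Y : ℝ) * ‖∑ w, g w‖ ≤ Fintype.card Y * Nat.card Z := by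
    calc (Fintype.card Y : ℝ) * ‖∑ w, g w‖ = ‖(Fintype.card Y : ℂ) * ∑ w, g w‖ := by simp
      _ = ‖∑ w ∈ Finset.univ.filter good, ∑ y : Y, g (w + y)‖ := by
        rw [hcard, Finset.sum_filter_of_ne]
        intro w _ hw
        by_contra hb
        exact hw (hz w hb)
      _ ≤ ∑ w ∈ Finset.univ.filter good, ∑ y : Y, (1 : ℝ) := by
        refine norm_sum_le_of_le _ fun w _ => norm_sum_le_of_le _ fun y _ => hg _
      _ = Fintype.card Y * (Finset.univ.filter good).card := by
        simp [mul_comm]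
      _ ≤ _ := by gcongr
  exact le_of_mul_le_mul_left h3 hY

/-- Polynomial representatives of power series modulo `X ^ p`. -/
def rp {p : ℕ} (a : Fin p → Fq) : PowerSeries Fq :=
  PowerSeries.mk fun i => if h : i < p then a ⟨i, h⟩ else 0

/-- Truncation. -/
def tr (p : ℕ) (g : PowerSeries Fq) : Fin p → Fq := fun i => PowerSeries.coeff i g

lemma rp_add {p : ℕ} (a a' : Fin p → Fq) : rp (a + a') = rp a + rp a' := by
  ext i
  simp only [rp, PowerSeries.coeff_mk, map_add]
  split_ifs <;> simp

lemma rp_sub {p : ℕ} (a a' : Fin p → Fq) : rp (a - a') = rp a - rp a' := by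
  ext i
  simp only [rp, PowerSeries.coeff_mk, map_sub]
  split_ifs <;> simp

lemma coeff_rp {p : ℕ} (a : Fin p → Fq) (i : Fin p) : PowerSeries.coeff (i : ℕ) (rp a) = a i := by
  simp [rp]

lemma rp_tr (p : ℕ) (g : PowerSeries Fq) : ∃ r, g = rp (tr p g) + PowerSeries.X ^ p * r := by
  have : PowerSeries.X ^ p ∣ g - rp (tr p g) := by
    rw [PowerSeries.X_pow_dvd_iff]
    intro m hm
    simp [rp, tr, hm]
  obtain ⟨r, hr⟩ := this
  exact ⟨r, by linear_combination hr⟩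

lemma rp_inj {p : ℕ} (a a' : Fin p → Fq) (h : PowerSeries.X ^ p ∣ rp a - rp a') : a = a' := by
  rw [PowerSeries.X_pow_dvd_iff] at h
  ext i
  have := h i i.2
  rw [map_sub, coeff_rp, coeff_rp] at this
  exact sub_eq_zero.1 this

/-- vectors whose first `k` coefficients vanish -/
def Yk (Fq : Type) [Field Fq] (n p k : ℕ) : AddSubgroup (Fin n → Fin p → Fq) where
  carrier := {a | ∀ i (j : Fin p), (j : ℕ) < k → a i j = 0}
  zero_mem' := by intro i j _; simp
  add_mem' := by intro a b ha hb i j hj; simp [ha i j hj, hb i j hj]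
  neg_mem' := by intro a ha i j hj; simp [ha i j hj]

lemma mem_Yk {n p k : ℕ} {a : Fin n → Fin p → Fq} :
    a ∈ Yk Fq n p k ↔ ∀ i, PowerSeries.X ^ k ∣ rp (a i) := by
  constructor
  · intro h i
    rw [PowerSeries.X_pow_dvd_iff]
    intro m hm
    simp only [rp, PowerSeries.coeff_mk]
    split_ifs with h1
    · exact h i ⟨m, h1⟩ hm
    · rfl
  · intro h i j hj
    have := PowerSeries.X_pow_dvd_iff.1 (h i) j hj
    rwa [coeff_rp] at this

lemma card_Yk [Fintype Fq] {n p k : ℕ} (hk : k ≤ p) :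
    Nat.card (Yk Fq n p k) ≤ Fintype.card Fq ^ ((p - k) * n) := by
  have hinj : Function.Injective (fun (a : Yk Fq n p k) (i : Fin n) (j : Fin (p - k)) =>
      (a : Fin n → Fin p → Fq) i ⟨k + j, by omega⟩) := by
    intro a a' h
    ext i j
    by_cases hj : (j : ℕ) < k
    · rw [a.2 i j hj, a'.2 i j hj]
    · have := congrFun (congrFun h i) ⟨j - k, by omega⟩
      simp only at this
      convert this using 2 <;> ext <;> simp <;> omega
  have := Nat.card_le_card_of_injective _ hinj
  refine this.trans ?_
  simp [pow_mul]

/-- The point `b + X w`. -/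
def pt {n : ℕ} (b : Fin n → Fq) (w : Fin n → PowerSeries Fq) : Fin n → PowerSeries Fq :=
  fun i => PowerSeries.C (b i) + PowerSeries.X * w i

lemma const_aeval {n : ℕ} (G : MvPolynomial (Fin n) Fq) (b : Fin n → Fq) (w : Fin n → PowerSeries Fq) :
    PowerSeries.constantCoeff (MvPolynomial.aeval (pt b w) G) = MvPolynomial.eval b G := by
  rw [MvPolynomial.aeval_def, MvPolynomial.hom_eval₂, MvPolynomial.eval, MvPolynomial.coe_eval₂Hom]
  congr 1
  · ext i; simp [pt]

lemma grad_inj {n : ℕ} (F : MvPolynomial (Fin n) Fq) (b : Fin n → Fq)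
    (hH : MvPolynomial.eval b (hessianDet F) ≠ 0) (x x' : Fin n → PowerSeries Fq) (m : ℕ)
    (h : ∀ i, PowerSeries.X ^ (m + 1) ∣ MvPolynomial.aeval (pt b x) (MvPolynomial.pderiv i F)
      - MvPolynomial.aeval (pt b x') (MvPolynomial.pderiv i F)) :
    ∀ i, PowerSeries.X ^ m ∣ x i - x' i := by
  suffices H : ∀ j ≤ m, ∀ i, PowerSeries.X ^ j ∣ x i - x' i from H m le_rfl
  intro j
  induction j with
  | zero => intro _ i; simp
  | succ j ih =>
    intro hj
    choose y hy using ih (by omega)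
    have hpt : pt b x = fun i => pt b x' i + PowerSeries.X ^ (j + 1) * y i := by
      funext i
      simp only [pt]
      linear_combination PowerSeries.X * hy i
    have hc : ∀ i, ∑ l, PowerSeries.constantCoeff (y l) *
        MvPolynomial.eval b (MvPolynomial.pderiv l (MvPolynomial.pderiv i F)) = 0 := by
      intro i
      obtain ⟨r, hr⟩ := taylor (MvPolynomial.pderiv i F) (PowerSeries.X ^ (j + 1)) (pt b x') y
      rw [← hpt] at hr
      have h1 : (PowerSeries.X : PowerSeries Fq) ^ (j + 1) * PowerSeries.X ∣ PowerSeries.X ^ (j + 1) *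
          (∑ l, y l * MvPolynomial.aeval (pt b x') (MvPolynomial.pderiv l (MvPolynomial.pderiv i F))
            + PowerSeries.X * (PowerSeries.X ^ j * r)) := by
        rw [← pow_succ]
        refine (pow_dvd_pow _ (by omega : j + 1 + 1 ≤ m + 1)).trans ?_
        convert h i using 1
        rw [hr]; ring
      have h2 := (mul_dvd_mul_iff_left (pow_ne_zero _ PowerSeries.X_ne_zero)).1 h1
      rw [PowerSeries.X_dvd_iff] at h2
      simpa [map_sum, pt] using h2
    set M : Matrix (Fin n) (Fin n) Fq := Matrix.of fun l i =>
      MvPolynomial.eval b (MvPolynomial.pderiv l (MvPolynomial.pderiv i F)) with hM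
    have hdet : M.det ≠ 0 := by
      rw [hessianDet, RingHom.map_det] at hH
      exact hH
    have hv : (fun l => PowerSeries.constantCoeff (y l)) = 0 := by
      apply Matrix.eq_zero_of_vecMul_eq_zero hdet
      funext i
      exact hc i
    intro i
    have h3 : PowerSeries.X ∣ y i := by
      rw [PowerSeries.X_dvd_iff]; exact congrFun hv i
    rw [hy i, pow_succ]
    exact mul_dvd_mul_left _ h3

/-- The phase function. -/
def Phi {n : ℕ} (F : MvPolynomial (Fin n) Fq) (b : Fin n → Fq) (A : Kinf Fq) (Lc : Fin n → Kinf Fq)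
    (κ : Kinf Fq) (w : Fin n → PowerSeries Fq) : Kinf Fq :=
  A * ofP (MvPolynomial.aeval (pt b w) F) + ∑ i, Lc i * ofP (w i) + κ

lemma Phi_diff {n : ℕ} (F : MvPolynomial (Fin n) Fq) (b : Fin n → Fq) (A : Kinf Fq)
    (Lc : Fin n → Kinf Fq) (κ : Kinf Fq) (w y : Fin n → PowerSeries Fq) (e : ℕ) :
    ∃ r : PowerSeries Fq, Phi F b A Lc κ (fun i => w i + PowerSeries.X ^ e * y i) - Phi F b A Lc κ w
      = ∑ i, (xp Fq e * (A * xp Fq 1 * ofP (MvPolynomial.aeval (pt b w) (MvPolynomial.pderiv i F)) + Lc i))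
          * ofP (y i) + A * xp Fq (2 * e + 2) * ofP r := by
  obtain ⟨r, hr⟩ := taylor F (PowerSeries.X ^ (e + 1)) (pt b w) y
  have hpt : pt b (fun i => w i + PowerSeries.X ^ e * y i)
      = fun i => pt b w i + PowerSeries.X ^ (e + 1) * y i := by
    funext i; simp only [pt]; ring
  refine ⟨r, ?_⟩
  unfold Phi
  rw [hpt, hr]
  simp only [map_add, map_mul, map_sum, ← pow_mul, xp_nat, mul_add, add_mul, Finset.sum_add_distrib]
  have e1 : ∑ i, Lc i * (xp Fq e * ofP (y i)) = ∑ i, xp Fq e * Lc i * ofP (y i) :=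
    Finset.sum_congr rfl fun i _ => by ring
  have e2 : ∑ i, xp Fq e * (A * xp Fq 1 * ofP (MvPolynomial.aeval (pt b w) (MvPolynomial.pderiv i F)))
      * ofP (y i) = A * (xp Fq ((e + 1 : ℕ) : ℤ) * ∑ i, ofP (y i) *
        ofP (MvPolynomial.aeval (pt b w) (MvPolynomial.pderiv i F))) := by
    rw [Finset.mul_sum, Finset.mul_sum]
    refine Finset.sum_congr rfl fun i _ => ?_
    push_cast
    rw [← xp_mul]; ring
  rw [e1, e2]
  have e3 : xp Fq ((e * 2 + 1 * 2 : ℕ) : ℤ) = xp Fq (2 * e + 2) := by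
    congr 1; push_cast; ring
  rw [e3]; ring

lemma Phi_period [Fintype Fq] [Algebra (ZMod (ringChar Fq)) Fq] [NeZero (ringChar Fq)] {n : ℕ}
    (F : MvPolynomial (Fin n) Fq) (b : Fin n → Fq) (A : Kinf Fq)
    (Lc : Fin n → Kinf Fq) (κ : Kinf Fq) (w y : Fin n → PowerSeries Fq) (α p : ℕ)
    (hA : A ∈ L Fq (-α)) (hp : α + 1 ≤ p) (hL : ∀ i, Lc i ∈ L Fq (2 - p)) :
    psiK (Phi F b A Lc κ (fun i => w i + PowerSeries.X ^ p * y i)) = psiK (Phi F b A Lc κ w) := by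
  obtain ⟨r, hr⟩ := Phi_diff F b A Lc κ w y p
  apply psi_congr
  rw [hr]
  refine add_mem (sum_mem fun i _ => L_mul_ofP ?_ _) (L_mul_ofP ?_ _)
  · rw [xp_mul_mem]
    refine add_mem (L_mul_ofP ?_ _) (hL i)
    rw [mul_comm, xp_mul_mem]
    exact L_mono (by omega) hA
  · rw [mul_comm, xp_mul_mem]
    exact L_mono (by omega) hA

lemma expsum [Fintype Fq] [Algebra (ZMod (ringChar Fq)) Fq] [Fact (ringChar Fq).Prime] {n : ℕ}
    (F : MvPolynomial (Fin n) Fq) (b : Fin n → Fq)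
    (hH : MvPolynomial.eval b (hessianDet F) ≠ 0) (A : Kinf Fq)
    (Lc : Fin n → Kinf Fq) (κ : Kinf Fq) (α p : ℕ)
    (hA : A ∈ L Fq (-α)) (hA' : ∀ (f : Kinf Fq) (s : ℤ), A * f ∈ L Fq s → f ∈ L Fq (s + α))
    (hp : α + 1 ≤ p) (hL : ∀ i, Lc i ∈ L Fq (2 - p)) :
    ‖∑ a : Fin n → Fin p → Fq, psiK (Phi F b A Lc κ fun i => rp (a i))‖
      ≤ (Fintype.card Fq : ℝ) ^ ((p - α / 2) * n) := by
  set m := α / 2 with hm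
  obtain ⟨k, hk⟩ : ∃ k, α = m + k := ⟨α - m, by omega⟩
  have hkm : m ≤ k := by omega
  have hY := card_Yk (Fq := Fq) (n := n) (p := p) (k := m) (by omega)
  refine le_trans (abstract_sum (Yk Fq n p k) (Yk Fq n p m) _ (fun w => (psi_norm _).le)
    (fun a => ∀ i, xp Fq k * (A * xp Fq 1 * ofP (MvPolynomial.aeval (pt b fun i => rp (a i))
      (MvPolynomial.pderiv i F)) + Lc i) ∈ L Fq 2) ?_ ?_) (by exact_mod_cast hY)
  · intro a ha
    push Not at ha
    obtain ⟨i, hi⟩ := ha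
    obtain ⟨y0, hy0⟩ := psi_exists hi
    set c := xp Fq k * (A * xp Fq 1 * ofP (MvPolynomial.aeval (pt b fun i => rp (a i))
      (MvPolynomial.pderiv i F)) + Lc i) with hc
    set yv : Fin n → PowerSeries Fq := Pi.single i y0 with hyv
    refine ⟨fun l => tr p (PowerSeries.X ^ k * yv l), ?_, psiK (c * ofP y0), hy0, ?_⟩
    · rw [mem_Yk]
      intro l
      obtain ⟨r, hr⟩ := rp_tr p (PowerSeries.X ^ k * yv l)
      have hr' : rp (tr p (PowerSeries.X ^ k * yv l)) = PowerSeries.X ^ k * yv l - PowerSeries.X ^ p * r := by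
        linear_combination - hr
      rw [hr']
      exact dvd_sub (Dvd.intro _ rfl) ((pow_dvd_pow _ (by omega)).trans (Dvd.intro _ rfl))
    · intro a' ha'
      rw [mem_Yk] at ha'
      choose y' hy' using ha'
      choose r hr using fun l => rp_tr p (PowerSeries.X ^ k * yv l)
      have e1 : (fun l => rp ((a + a' + (fun l => tr p (PowerSeries.X ^ k * yv l) : Fin n → Fin p → Fq)) l))
          = fun l => ((fun l => rp ((a + a') l) + PowerSeries.X ^ k * yv l) l) +
              PowerSeries.X ^ p * (- r l) := by
        funext l
        rw [Pi.add_apply, rp_add]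
        linear_combination - hr l
      rw [e1, Phi_period F b A Lc κ _ _ α p hA hp hL]
      obtain ⟨r1, hr1⟩ := Phi_diff F b A Lc κ (fun l => rp ((a + a') l)) yv k
      have e2 : pt b (fun l => rp ((a + a') l)) = fun l => pt b (fun l => rp (a l)) l
          + PowerSeries.X ^ (k + 1) * y' l := by
        funext l
        simp only [pt, Pi.add_apply, rp_add, hy']
        ring
      obtain ⟨r2, hr2⟩ := taylor (MvPolynomial.pderiv i F) (PowerSeries.X ^ (k + 1))
        (pt b (fun l => rp (a l))) y'
      rw [← e2] at hr2
      rw [mul_comm, ← psi_add]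
      apply psi_congr
      rw [Finset.sum_eq_single i] at hr1
      rotate_left
      · intro l _ hl; simp [hyv, hl]
      · simp
      have e3 : yv i = y0 := by simp [hyv]
      rw [e3, hr2] at hr1
      rw [← sub_sub, hr1, hc]
      have hAx : A * xp Fq (2 * k + 2) ∈ L Fq 2 := by
        rw [mul_comm, xp_mul_mem]
        exact L_mono (by omega) hA
      have := L_mul_ofP hAx (y0 * ((∑ l, y' l * MvPolynomial.aeval (pt b (fun l => rp (a l)))
        (MvPolynomial.pderiv l (MvPolynomial.pderiv i F))) + PowerSeries.X ^ (k + 1) * r2) + r1)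
      convert this using 1
      have e4 : xp Fq (2 * k + 2) = xp Fq k * xp Fq 1 * ofP (PowerSeries.X ^ (k + 1)) := by
        rw [xp_nat, xp_mul, xp_mul]; congr 1; push_cast; ring
      rw [e4]
      simp only [map_add, map_mul, map_pow]
      ring
  · intro a a' ha ha'
    rw [mem_Yk]
    have := grad_inj F b hH (fun i => rp (a i)) (fun i => rp (a' i)) m ?_
    · intro i
      have h1 := this i
      rwa [← rp_sub] at h1
    · intro i
      have h1 := sub_mem (ha i) (ha' i)
      rw [← mul_sub, add_sub_add_right_eq_sub, ← mul_sub, ← map_sub, mul_assoc, xp_mul_mem] at h1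
      have h2 := hA' _ _ h1
      rw [xp_mul_mem] at h2
      obtain ⟨r, hr⟩ := ofP_mem_nat (k := m + 1) (L_mono (by push_cast; omega) h2)
      exact ⟨r, hr⟩

/-- Cosets of the fractional ideals. -/
def coset (c : Kinf Fq) (s : ℤ) : Set (Kinf Fq) := {u | u - c ∈ L Fq s}

/-- Representatives. -/
def rep {p : ℕ} (s : ℤ) (a : Fin p → Fq) : Kinf Fq := xp Fq s * ofP (rp a)

lemma rep_exists {s : ℤ} {f : Kinf Fq} (hf : f ∈ L Fq s) (p : ℕ) :
    ∃ a : Fin p → Fq, f - rep s a ∈ L Fq (s + p) := by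
  obtain ⟨g, rfl⟩ := mem_L_iff.1 hf
  refine ⟨tr p g, ?_⟩
  obtain ⟨r, hr⟩ := rp_tr p g
  refine mem_L_iff.2 ⟨r, ?_⟩
  rw [rep, ← mul_sub, ← map_sub]
  have : g - rp (tr p g) = PowerSeries.X ^ p * r := by linear_combination hr
  rw [this, map_mul, xp_nat, ← xp_mul, mul_assoc]

lemma rep_unique {s : ℤ} {p : ℕ} {a a' : Fin p → Fq} (h : rep s a - rep s a' ∈ L Fq (s + p)) : a = a' := by
  rw [rep, rep, ← mul_sub, ← map_sub, xp_mul_mem] at h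
  obtain ⟨r, hr⟩ := ofP_mem_nat (k := p) (L_mono (by omega) h)
  exact rp_inj _ _ ⟨r, hr⟩

section meas
variable [Fintype Fq] [MeasurableSpace (Kinf Fq)] (μ : Measure (Kinf Fq))

lemma meas_coset (h1 : ∀ a : Kinf Fq, ∀ s : Set (Kinf Fq), μ ((a + ·) ⁻¹' s) = μ s)
    (h2 : ∀ N : ℤ, μ {α : Kinf Fq | absK α < (Fintype.card Fq : ℝ) ^ N}
          = ENNReal.ofReal ((Fintype.card Fq : ℝ) ^ N)) (c : Kinf Fq) (s : ℤ) :
    μ (coset c s) = ENNReal.ofReal ((Fintype.card Fq : ℝ) ^ (1 - s)) := by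
  rw [← h2, ← h1 (-c) {α : Kinf Fq | absK α < (Fintype.card Fq : ℝ) ^ (1 - s)}]
  congr 1
  ext u
  simp only [coset, Set.mem_ofPred_eq, Set.mem_preimage, absK_lt]
  rw [neg_add_eq_sub]
  simp

lemma null_aux (h1 : ∀ a : Kinf Fq, ∀ s : Set (Kinf Fq), μ ((a + ·) ⁻¹' s) = μ s)
    (h2 : ∀ N : ℤ, μ {α : Kinf Fq | absK α < (Fintype.card Fq : ℝ) ^ N}
          = ENNReal.ofReal ((Fintype.card Fq : ℝ) ^ N)) (c : Kinf Fq) (s j : ℤ) (hsj : s ≤ j)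
    (hc : c ∈ L Fq s) : μ ((toMeasurable μ (coset c j) ∩ coset 0 s) \ coset c j) = 0 := by
  have hq : (0 : ℝ) < Fintype.card Fq := by exact_mod_cast Fintype.card_pos
  obtain ⟨p, hp⟩ : ∃ p : ℕ, j = s + p := ⟨(j - s).toNat, by omega⟩
  obtain ⟨a0, ha0⟩ := rep_exists hc p
  rw [← hp] at ha0
  set x := ENNReal.ofReal ((Fintype.card Fq : ℝ) ^ (1 - j)) with hx
  set D := coset 0 s \ coset c j with hD
  have hDsub : D ⊆ ⋃ a ∈ Finset.univ.erase a0, coset (rep s a : Kinf Fq) j := by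
    rintro u ⟨hu, hu'⟩
    have hu0 : u ∈ L Fq s := by simpa [coset] using hu
    obtain ⟨a, ha⟩ := rep_exists hu0 p
    rw [← hp] at ha
    simp only [Set.mem_iUnion]
    refine ⟨a, Finset.mem_erase.2 ⟨?_, Finset.mem_univ _⟩, ha⟩
    rintro rfl
    apply hu'
    have := sub_mem ha ha0
    simpa [coset] using this
  have hDle : x + μ D ≤ μ (coset (0 : Kinf Fq) s) := by
    calc x + μ D ≤ x + ∑ a ∈ Finset.univ.erase a0, μ (coset (rep s a : Kinf Fq) j) := by
          gcongr
          exact (measure_mono hDsub).trans (measure_biUnion_finset_le _ _)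
      _ = ∑ a : Fin p → Fq, μ (coset (rep s a : Kinf Fq) j) := by
          rw [← Finset.add_sum_erase _ _ (Finset.mem_univ a0), meas_coset μ h1 h2]
      _ = μ (coset (0 : Kinf Fq) s) := by
          simp only [meas_coset μ h1 h2, Finset.sum_const, Finset.card_univ, nsmul_eq_mul]
          rw [← ENNReal.ofReal_natCast, ← ENNReal.ofReal_mul (by positivity)]
          congr 1
          simp only [Fintype.card_pi, Finset.prod_const, Finset.card_univ, Fintype.card_fin]
          push_cast
          rw [← zpow_natCast, ← zpow_add₀ hq.ne']
          congr 1; omega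
  set E := toMeasurable μ (coset c j) with hE
  set E' := toMeasurable μ D with hE'
  have hfin : μ (coset (0 : Kinf Fq) s) ≠ ⊤ := by rw [meas_coset μ h1 h2]; exact ENNReal.ofReal_ne_top
  have h3 : μ (coset (0 : Kinf Fq) s) + μ (E ∩ E') ≤ μ (coset (0 : Kinf Fq) s) := by
    calc μ (coset (0 : Kinf Fq) s) + μ (E ∩ E') ≤ μ (E ∪ E') + μ (E ∩ E') := by
          gcongr
          intro u hu
          by_cases h : u ∈ coset c j
          · exact Or.inl (subset_toMeasurable _ _ h)
          · exact Or.inr (subset_toMeasurable _ _ ⟨hu, h⟩)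
      _ = μ E + μ E' := measure_union_add_inter _ (measurableSet_toMeasurable _ _)
      _ = x + μ D := by rw [hE, hE', measure_toMeasurable, measure_toMeasurable, meas_coset μ h1 h2]
      _ ≤ _ := hDle
  have h4 : μ (E ∩ E') = 0 := by
    have : μ (coset (0 : Kinf Fq) s) + μ (E ∩ E') ≤ μ (coset (0 : Kinf Fq) s) + 0 := by simpa using h3
    have := (ENNReal.add_le_add_iff_left hfin).1 this
    simpa using this
  refine measure_mono_null ?_ h4
  rintro u ⟨⟨hu1, hu2⟩, hu3⟩
  exact ⟨hu1, subset_toMeasurable _ _ ⟨hu2, hu3⟩⟩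

lemma null_coset (h1 : ∀ a : Kinf Fq, ∀ s : Set (Kinf Fq), μ ((a + ·) ⁻¹' s) = μ s)
    (h2 : ∀ N : ℤ, μ {α : Kinf Fq | absK α < (Fintype.card Fq : ℝ) ^ N}
          = ENNReal.ofReal ((Fintype.card Fq : ℝ) ^ N)) (c : Kinf Fq) (j : ℤ) :
    NullMeasurableSet (coset c j) μ := by
  refine (measurableSet_toMeasurable μ (coset c j)).nullMeasurableSet.congr ?_
  refine Filter.EventuallyLE.antisymm ?_ (subset_toMeasurable μ _).eventuallyLE
  rw [ae_le_set]
  obtain ⟨s0, hs0⟩ := exists_mem_L c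
  have : toMeasurable μ (coset c j) \ coset c j ⊆
      ⋃ N : ℕ, (toMeasurable μ (coset c j) ∩ coset 0 (min s0 j - N)) \ coset c j := by
    rintro u ⟨hu, hu'⟩
    obtain ⟨s1, hs1⟩ := exists_mem_L u
    refine Set.mem_iUnion.2 ⟨(min s0 j - s1).toNat, ⟨hu, ?_⟩, hu'⟩
    have : u ∈ L Fq (min s0 j - ((min s0 j - s1).toNat : ℕ)) := L_mono (by omega) hs1
    simpa [coset] using this
  refine measure_mono_null this (measure_iUnion_null fun N => ?_)
  exact null_aux μ h1 h2 c _ j (by omega) (L_mono (by omega) hs0)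

lemma integral_eq [SigmaFinite μ] (h1 : ∀ a : Kinf Fq, ∀ s : Set (Kinf Fq), μ ((a + ·) ⁻¹' s) = μ s)
    (h2 : ∀ N : ℤ, μ {α : Kinf Fq | absK α < (Fintype.card Fq : ℝ) ^ N}
          = ENNReal.ofReal ((Fintype.card Fq : ℝ) ^ N)) {n p : ℕ} (v : Fin n → Kinf Fq)
    (f : (Fin n → Kinf Fq) → ℂ) (g : (Fin n → Fin p → Fq) → ℂ)
    (hfg : ∀ a u, (∀ i, u i ∈ coset (v i + rep 2 (a i)) (2 + p)) → f u = g a) :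
    ∫ u in Set.pi Set.univ (fun i => coset (v i) 2), f u ∂(Measure.pi fun _ : Fin n => μ)
      = ((((Fintype.card Fq : ℝ) ^ (-1 - p : ℤ)) ^ n : ℝ) : ℂ) * ∑ a, g a := by
  set B : (Fin n → Fin p → Fq) → Set (Fin n → Kinf Fq) := fun a =>
    Set.pi Set.univ (fun i => coset (v i + rep 2 (a i)) (2 + p)) with hB
  have hU : Set.pi Set.univ (fun i => coset (v i) 2) = ⋃ a, B a := by
    ext u
    simp only [Set.mem_pi, Set.mem_univ, true_imp_iff, Set.mem_iUnion, hB]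
    constructor
    · intro h
      choose a ha using fun i => rep_exists (h i) p
      refine ⟨a, fun i => ?_⟩
      have := ha i
      rwa [sub_sub] at this
    · rintro ⟨a, ha⟩ i
      have h3 : rep 2 (a i) ∈ L Fq 2 := mem_L_iff.2 ⟨_, rfl⟩
      have h4 : u i - (v i + rep 2 (a i)) ∈ L Fq 2 := L_mono (by omega) (ha i)
      have := add_mem h4 h3
      rw [← sub_sub, sub_add_cancel] at this
      exact this
  have hnull : ∀ a, NullMeasurableSet (B a) (Measure.pi fun _ : Fin n => μ) := by
    intro a
    have : B a = ⋂ i, (Function.eval i) ⁻¹' coset (v i + rep 2 (a i)) (2 + p) := by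
      ext u; simp [hB]
    rw [this]
    refine NullMeasurableSet.iInter fun i => ?_
    exact (null_coset μ h1 h2 _ _).preimage (Measure.quasiMeasurePreserving_eval (fun _ : Fin n => μ) i)
  have hmeas : ∀ a, Measure.pi (fun _ : Fin n => μ) (B a)
      = ENNReal.ofReal (((Fintype.card Fq : ℝ) ^ (-1 - p : ℤ)) ^ n) := by
    intro a
    rw [hB, Measure.pi_pi]
    simp only [meas_coset μ h1 h2, Finset.prod_const, Finset.card_univ, Fintype.card_fin]
    rw [ENNReal.ofReal_pow (by positivity)]
    congr 3; omega
  have hdisj : Pairwise (Function.onFun (AEDisjoint (Measure.pi fun _ : Fin n => μ)) B) := by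
    intro a a' haa
    apply Disjoint.aedisjoint
    rw [Set.disjoint_left]
    intro u hu hu'
    apply haa
    funext i
    have e1 : u i - (v i + rep 2 (a i)) ∈ L Fq (2 + p) := hu i (Set.mem_univ _)
    have e2 : u i - (v i + rep 2 (a' i)) ∈ L Fq (2 + p) := hu' i (Set.mem_univ _)
    have := sub_mem e2 e1
    rw [sub_sub_sub_cancel_left, add_sub_add_left_eq_sub] at this
    exact rep_unique this
  have hae : ∀ a, f =ᵐ[(Measure.pi fun _ : Fin n => μ).restrict (B a)] fun _ => g a := by
    intro a
    rw [Filter.EventuallyEq, ae_restrict_iff'₀ (hnull a)]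
    exact Filter.Eventually.of_forall fun u hu => hfg a u fun i => hu i (Set.mem_univ _)
  have hint : IntegrableOn f (⋃ a, B a) (Measure.pi fun _ : Fin n => μ) := by
    rw [integrableOn_finite_iUnion]
    intro a
    refine Integrable.congr ?_ (hae a).symm
    refine integrableOn_const ?_ ?_
    · rw [hmeas]; exact ENNReal.ofReal_ne_top
    · exact enorm_ne_top
  rw [hU, integral_iUnion_ae hnull hdisj hint, tsum_fintype, Finset.mul_sum]
  refine Finset.sum_congr rfl fun a _ => ?_
  rw [integral_congr_ae (hae a), setIntegral_const, Measure.real, hmeas,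
    ENNReal.toReal_ofReal (by positivity), Complex.real_smul]

end meas

lemma region_eq [Fintype Fq] {n : ℕ} (b : Fin n → Fq) : {u : Fin n → Kinf Fq |
      ∀ i, absK (tvar Fq * u i - algebraMap Fq (Kinf Fq) (b i)) < 1}
    = Set.pi Set.univ (fun i => coset (xp Fq 1 * ofP (PowerSeries.C (b i))) 2) := by
  ext u
  simp only [Set.mem_pi, Set.mem_univ, true_imp_iff]
  refine forall_congr' fun i => ?_
  have := absK_lt (tvar Fq * u i - algebraMap Fq (Kinf Fq) (b i)) 0
  rw [zpow_zero] at this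
  rw [this, algebraMap_eq, tvar_eq]
  have e : xp Fq (-1) * u i - ofP (PowerSeries.C (b i))
      = xp Fq (-1) * (u i - xp Fq 1 * ofP (PowerSeries.C (b i))) := by
    rw [mul_sub, ← mul_assoc, xp_mul]; norm_num [xp_zero]
  rw [e, xp_mul_mem]
  rfl

lemma exists_unit {f : Kinf Fq} (hf : f ≠ 0) : ∃ U V : PowerSeries Fq, f = xp Fq f.order * ofP U ∧ U * V = 1 := by
  have h : f ∈ L Fq f.order := fun _ hj => HahnSeries.coeff_eq_zero_of_lt_order hj
  obtain ⟨U, hU⟩ := mem_L_iff.1 h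
  have h0 : PowerSeries.constantCoeff U ≠ 0 := by
    have h1 : f.coeff f.order ≠ 0 := by
      rw [Ne, HahnSeries.coeff_order_eq_zero]; exact hf
    have h2 : f.coeff f.order = (xp Fq f.order * ofP U).coeff f.order := congrArg (fun g => g.coeff f.order) hU
    rw [h2, coeff_xp_mul, sub_self] at h1
    have := coeff_ofP_nat U 0
    rw [Nat.cast_zero] at this
    rw [this] at h1
    simpa using h1
  exact ⟨U, U⁻¹, hU, PowerSeries.mul_inv_cancel U h0⟩

lemma integrand_eq {n d : ℕ} (F : MvPolynomial (Fin n) Fq) (hF : F.IsHomogeneous 3) (b : Fin n → Fq)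
    (ρ θ : Kinf Fq) (c : Fin n → Polynomial Fq) (w : Fin n → PowerSeries Fq) (u : Fin n → Kinf Fq)
    (hu : ∀ i, u i = xp Fq 1 * ofP (pt b w i)) :
    θ * (tvar Fq) ^ (3 * (d + 1)) * MvPolynomial.aeval u F
            + (tvar Fq) ^ (d + 1) * (∑ i, polyK (c i) * u i) * ρ
      = Phi F b (θ * (tvar Fq) ^ (3 * (d + 1)) * xp Fq 3)
        (fun i => (tvar Fq) ^ (d + 1) * polyK (c i) * ρ * xp Fq 2)
        (∑ i, (tvar Fq) ^ (d + 1) * polyK (c i) * ρ * (xp Fq 1 * ofP (PowerSeries.C (b i)))) w := by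
  have hu' : u = fun i => xp Fq 1 * ofP (pt b w i) := funext hu
  rw [hu', aeval_smul_hom F hF, aeval_ofP, Phi]
  have e3 : xp Fq 1 ^ 3 = xp Fq 3 := by simp [xp]
  rw [e3, add_assoc, ← Finset.sum_add_distrib, Finset.mul_sum, Finset.sum_mul]
  congr 1
  · ring
  · refine Finset.sum_congr rfl fun i _ => ?_
    have e2 : xp Fq 2 = xp Fq 1 * xp Fq 1 := by rw [xp_mul]; norm_num
    simp only [pt, map_add, map_mul, xp_one, e2]
    ring

lemma main (n d : ℕ) [Fintype Fq] [Algebra (ZMod (ringChar Fq)) Fq]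
      [MeasurableSpace (Kinf Fq)] (μ : Measure (Kinf Fq)) [SigmaFinite μ]
      (h1 : ∀ a : Kinf Fq, ∀ s : Set (Kinf Fq), μ ((a + ·) ⁻¹' s) = μ s)
      (h2 : ∀ N : ℤ, μ {α : Kinf Fq | absK α < (Fintype.card Fq : ℝ) ^ N}
          = ENNReal.ofReal ((Fintype.card Fq : ℝ) ^ N))
      (hchar : 3 < ringChar Fq)
      (F : MvPolynomial (Fin n) Fq) (hF : F.IsHomogeneous 3)
      (b : Fin n → Fq) (hH : MvPolynomial.eval b (hessianDet F) ≠ 0)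
      (rt : Polynomial Fq) (θ : Kinf Fq) (c : Fin n → Polynomial Fq) :
        ‖∫ u in {u : Fin n → Kinf Fq |
            ∀ i, absK (tvar Fq * u i - algebraMap Fq (Kinf Fq) (b i)) < 1},
          psiK (θ * (tvar Fq) ^ (3 * (d + 1)) * MvPolynomial.aeval u F
            + (tvar Fq) ^ (d + 1) * (∑ i, polyK (c i) * u i) * (polyK rt)⁻¹)
          ∂(MeasureTheory.Measure.pi fun _ : Fin n => μ)‖
          ≤ 1 * (Fintype.card Fq : ℝ) ^ (-(n : ℤ)) ∧
        (θ ≠ 0 →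
          ‖∫ u in {u : Fin n → Kinf Fq |
              ∀ i, absK (tvar Fq * u i - algebraMap Fq (Kinf Fq) (b i)) < 1},
            psiK (θ * (tvar Fq) ^ (3 * (d + 1)) * MvPolynomial.aeval u F
              + (tvar Fq) ^ (d + 1) * (∑ i, polyK (c i) * u i) * (polyK rt)⁻¹)
            ∂(MeasureTheory.Measure.pi fun _ : Fin n => μ)‖
            ≤ 1 * (Fintype.card Fq : ℝ) ^ (n : ℤ)
              * (absK θ * (Fintype.card Fq : ℝ) ^ (3 * (d + 1))) ^ (-(n : ℝ) / 2)) := by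
  have hq : (1 : ℝ) < Fintype.card Fq := by exact_mod_cast Fintype.one_lt_card
  have hq0 : (0 : ℝ) < Fintype.card Fq := by linarith
  have hprime : Fact (ringChar Fq).Prime := by
    refine ⟨?_⟩
    rcases CharP.char_is_prime_or_zero Fq (ringChar Fq) with h | h
    · exact h
    · omega
  rw [region_eq]
  simp only [one_mul]
  set q : ℝ := (Fintype.card Fq : ℝ) with hqdef
  have hS : Measure.pi (fun _ : Fin n => μ)
      (Set.pi Set.univ (fun i => coset (xp Fq 1 * ofP (PowerSeries.C (b i))) 2))
      = ENNReal.ofReal (q ^ (-(n : ℤ))) := by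
    rw [Measure.pi_pi]
    simp only [meas_coset μ h1 h2, Finset.prod_const, Finset.card_univ, Fintype.card_fin]
    rw [← ENNReal.ofReal_pow (by positivity), ← zpow_natCast, ← zpow_mul]
    congr 2; ring
  have part1 := norm_setIntegral_le_of_norm_le_const (C := 1)
    (f := fun u : Fin n → Kinf Fq => psiK (θ * (tvar Fq) ^ (3 * (d + 1)) * MvPolynomial.aeval u F
            + (tvar Fq) ^ (d + 1) * (∑ i, polyK (c i) * u i) * (polyK rt)⁻¹))
    (μ := Measure.pi (fun _ : Fin n => μ))
    (s := Set.pi Set.univ (fun i => coset (xp Fq 1 * ofP (PowerSeries.C (b i))) 2))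
    (by rw [hS]; exact ENNReal.ofReal_lt_top) (fun u _ => (psi_norm _).le)
  rw [Measure.real, hS, ENNReal.toReal_ofReal (by positivity), one_mul] at part1
  refine ⟨part1, fun hθ => ?_⟩
  obtain ⟨U, V, hU, hUV⟩ := exists_unit hθ
  set αz : ℤ := 3 * (d + 1) - 3 - θ.order with hαz
  have hsize : absK θ * q ^ (3 * (d + 1)) = q ^ (αz + 3) := by
    rw [absK, if_neg hθ, ← zpow_natCast, ← zpow_add₀ hq0.ne']
    congr 1; rw [hαz]; push_cast; ring
  have hrhs : q ^ (n : ℤ) * (absK θ * q ^ (3 * (d + 1))) ^ (-(n : ℝ) / 2)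
      = q ^ ((n : ℝ) - ((αz : ℝ) + 3) * n / 2) := by
    rw [hsize, ← Real.rpow_intCast q n, ← Real.rpow_intCast q (αz + 3), ← Real.rpow_mul hq0.le,
      ← Real.rpow_add hq0]
    congr 1; push_cast; ring
  rw [hrhs]
  have hn0 : (0 : ℝ) ≤ n := Nat.cast_nonneg n
  by_cases hα : αz ≤ 1
  · refine part1.trans ?_
    rw [← Real.rpow_intCast]
    refine Real.rpow_le_rpow_of_exponent_le hq.le ?_
    have : (αz : ℝ) ≤ 1 := by exact_mod_cast hα
    push_cast
    nlinarith
  obtain ⟨α, hαn⟩ : ∃ α : ℕ, (α : ℤ) = αz := ⟨αz.toNat, by omega⟩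
  set A := θ * (tvar Fq) ^ (3 * (d + 1)) * xp Fq 3 with hAdef
  set Lc : Fin n → Kinf Fq := fun i => (tvar Fq) ^ (d + 1) * polyK (c i) * (polyK rt)⁻¹ * xp Fq 2 with hLc
  set κ := ∑ i, (tvar Fq) ^ (d + 1) * polyK (c i) * (polyK rt)⁻¹ * (xp Fq 1 * ofP (PowerSeries.C (b i)))
    with hκ
  have hAeq : A = xp Fq (-α) * ofP U := by
    have e : xp Fq (-α) = xp Fq θ.order * xp Fq (-((3 * (d + 1) : ℕ) : ℤ)) * xp Fq 3 := by
      rw [xp_mul, xp_mul]; congr 1; push_cast; omega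
    rw [e, hAdef, tvar_pow]
    nth_rewrite 1 [hU]
    ring
  have hA : A ∈ L Fq (-α) := mem_L_iff.2 ⟨U, hAeq⟩
  have hA' : ∀ (f : Kinf Fq) (s : ℤ), A * f ∈ L Fq s → f ∈ L Fq (s + α) := by
    intro f s hf
    have h3 := L_mul_ofP hf V
    have e : A * f * ofP V = xp Fq (-α) * f := by
      have : ofP U * ofP V = 1 := by rw [← map_mul, hUV, map_one]
      rw [hAeq]
      linear_combination xp Fq (-α) * f * this
    rw [e, xp_mul_mem] at h3
    simpa using h3
  choose s hs using fun i => exists_mem_L (Lc i)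
  obtain ⟨p, hp, hpL⟩ : ∃ p : ℕ, α + 1 ≤ p ∧ ∀ i, Lc i ∈ L Fq (2 - p) := by
    refine ⟨α + 1 + ∑ i, (2 - s i).toNat, by omega, fun i => L_mono ?_ (hs i)⟩
    have := Finset.single_le_sum (f := fun i => (2 - s i).toNat) (fun _ _ => Nat.zero_le _)
      (Finset.mem_univ i)
    omega
  have hmain := expsum F b hH A Lc κ α p hA hA' hp hpL
  rw [integral_eq μ h1 h2 (p := p) _ _ (fun a => psiK (Phi F b A Lc κ fun i => rp (a i))) ?_]
  · rw [norm_mul, Complex.norm_real, Real.norm_of_nonneg (by positivity)]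
    refine (mul_le_mul_of_nonneg_left hmain (by positivity)).trans ?_
    rw [← hqdef, ← zpow_natCast (q ^ (-1 - p : ℤ)) n, ← zpow_mul, ← zpow_natCast q, ← zpow_add₀ hq0.ne',
      ← Real.rpow_intCast]
    refine Real.rpow_le_rpow_of_exponent_le hq.le ?_
    have hm : α / 2 ≤ p := by omega
    have h5 : α ≤ 2 * (α / 2) + 1 := by omega
    generalize α / 2 = m at hm h5 ⊢
    have h6 : (α : ℝ) ≤ 2 * (m : ℝ) + 1 := by exact_mod_cast h5
    push_cast [Nat.cast_sub hm]
    have h7 : (αz : ℝ) = α := by rw [← hαn]; simp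
    rw [h7]
    nlinarith
  · intro a u hu
    choose y hy using fun i => mem_L_iff.1 (hu i)
    rw [← Phi_period F b A Lc κ (fun i => rp (a i)) y α p hA hp hpL]
    congr 1
    apply integrand_eq F hF
    intro i
    have e2 : xp Fq 2 = xp Fq 1 * xp Fq 1 := by rw [xp_mul]; norm_num
    have h3 := hy i
    rw [← xp_mul, rep, e2] at h3
    simp only [pt, map_add, map_mul, xp_one, xp_nat]
    linear_combination h3

end S16

/-- the bound `|I_{r̃}(θ; c)| ≪ min{q^{-n}, q^{n}|θP³|^{-n/2}}`,
with implied constant independent of `q`. -/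
theorem stmt_16 (n d : ℕ) (hn : 10 ≤ n) (hd : 1 ≤ d) : ∃ C : ℝ, 0 < C ∧
    ∀ (Fq : Type) [Field Fq] [Fintype Fq] [Algebra (ZMod (ringChar Fq)) Fq]
      [MeasurableSpace (Kinf Fq)] (μ : Measure (Kinf Fq)) [SigmaFinite μ],
      (∀ a : Kinf Fq, ∀ s : Set (Kinf Fq), μ ((a + ·) ⁻¹' s) = μ s) →
      (∀ N : ℤ, μ {α : Kinf Fq | absK α < (Fintype.card Fq : ℝ) ^ N}
          = ENNReal.ofReal ((Fintype.card Fq : ℝ) ^ N)) →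
      3 < ringChar Fq →
      ∀ (F : MvPolynomial (Fin n) Fq), F.IsHomogeneous 3 → NonsingularForm F →
      ∀ (b : Fin n → Fq), MvPolynomial.eval b F = 0 →
        MvPolynomial.eval b (hessianDet F) ≠ 0 →
      ∀ (rt : Polynomial Fq), rt.Monic →
      ∀ (θ : Kinf Fq) (c : Fin n → Polynomial Fq),
        ‖∫ u in {u : Fin n → Kinf Fq |
            ∀ i, absK (tvar Fq * u i - algebraMap Fq (Kinf Fq) (b i)) < 1},
          psiK (θ * (tvar Fq) ^ (3 * (d + 1)) * MvPolynomial.aeval u F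
            + (tvar Fq) ^ (d + 1) * (∑ i, polyK (c i) * u i) * (polyK rt)⁻¹)
          ∂(MeasureTheory.Measure.pi fun _ : Fin n => μ)‖
          ≤ C * (Fintype.card Fq : ℝ) ^ (-(n : ℤ)) ∧
        (θ ≠ 0 →
          ‖∫ u in {u : Fin n → Kinf Fq |
              ∀ i, absK (tvar Fq * u i - algebraMap Fq (Kinf Fq) (b i)) < 1},
            psiK (θ * (tvar Fq) ^ (3 * (d + 1)) * MvPolynomial.aeval u F
              + (tvar Fq) ^ (d + 1) * (∑ i, polyK (c i) * u i) * (polyK rt)⁻¹)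
            ∂(MeasureTheory.Measure.pi fun _ : Fin n => μ)‖
            ≤ C * (Fintype.card Fq : ℝ) ^ (n : ℤ)
              * (absK θ * (Fintype.card Fq : ℝ) ^ (3 * (d + 1))) ^ (-(n : ℝ) / 2)) := by
  refine ⟨1, one_pos, ?_⟩
  intro Fq _ _ _ _ μ _ h1 h2 hchar F hF _ b _ hH rt _ θ c
  exact S16.main n d μ h1 h2 hchar F hF b hH rt θ c
end
end
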